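/- arXiv:2402.13198 — 2 statements merged into one kernel-verified Lean document; each statement's English description precedes it below -/
import Mathlib

section
/- Let F ∈ ℤ[X,Y] be a binary form (a homogeneous polynomial) of degree t ≥ 4 which is irreducible over ℚ. For every ε > 0 there exists x₀ such that for all real x ≥ x₀ and all real y with x^{t−2} ≤ y ≤ x^t, setting u := log x / log y, one has #{(a,b) ∈ ℕ² : 1 ≤ a,b ≤ x, F(a,b) ≠ 0, P⁺(|F(a,b)|) ≤ y} ≥ (1 − (t−2)·u − ε)·x². -/
attribute [local instance] Classical.propDecidable

/-- Largest prime factor, with the convention `Pplus 1 = 1`. -/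
def Pplus (n : ℕ) : ℕ := max 1 (n.primeFactors.sup id)

theorem exists_small_solution_of_abs_le {p m : ℕ} {c d : ℤ} (hcd : IsCoprime c d)
    (hc : c.natAbs = m) (hd : d.natAbs ≤ m) (hm : m ^ 2 ≤ p) (hm0 : 0 < m) {k : ℤ}
    (hk0 : 0 ≤ k) (hkp : k ≤ p) :
    ∃ e₁ e₂ : ℤ, c * e₂ - d * e₁ = k ∧ |e₁| ≤ (2 * p / m : ℕ) ∧ |e₂| ≤ (2 * p / m : ℕ) := by
  obtain ⟨a, b, hab⟩ := hcd
  have hc0 : c ≠ 0 := by omega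
  have hcm : |c| = m := by rw [← hc]; simp
  have hdm : |d| ≤ m := by rw [Int.abs_eq_natAbs]; exact_mod_cast hd
  set e₁ := (-b * k) % c with he₁
  have h0 : 0 ≤ e₁ := Int.emod_nonneg _ hc0
  have h1 : e₁ < m := hcm ▸ Int.emod_lt_abs _ hc0
  have hdvd : c ∣ k + d * e₁ := by
    have : e₁ = -b * k - c * ((-b * k) / c) := by rw [he₁, Int.emod_def]
    refine ⟨k * a - d * ((-b * k) / c), ?_⟩
    rw [this]
    linear_combination (-k) * hab
  obtain ⟨e₂, he₂⟩ := hdvd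
  have hmp : (m : ℤ) ^ 2 ≤ p := by exact_mod_cast hm
  refine ⟨e₁, e₂, by linarith, ?_, ?_⟩
  · rw [abs_of_nonneg h0]
    have : m ≤ 2 * p / m := by
      rw [Nat.le_div_iff_mul_le hm0]; nlinarith
    have : (m : ℤ) ≤ (2 * p / m : ℕ) := by exact_mod_cast this
    linarith
  · have h2 : |e₂| * m ≤ 2 * p := by
      have : |c * e₂| = |e₂| * m := by rw [abs_mul, hcm, mul_comm]
      rw [← this, ← he₂]
      calc |k + d * e₁| ≤ |k| + |d * e₁| := abs_add_le _ _
        _ = k + |d| * e₁ := by rw [abs_mul, abs_of_nonneg hk0, abs_of_nonneg h0]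
        _ ≤ p + m * m := by gcongr
        _ ≤ 2 * p := by nlinarith
    have : e₂.natAbs ≤ 2 * p / m := by
      rw [Nat.le_div_iff_mul_le hm0]
      zify
      exact h2
    rw [Int.abs_eq_natAbs]; exact_mod_cast this

theorem exists_small_solution {p m : ℕ} {c d : ℤ} (hcd : IsCoprime c d)
    (hmax : max c.natAbs d.natAbs = m) (hm : m ^ 2 ≤ p) (hm0 : 0 < m) {k : ℤ}
    (hk0 : 0 ≤ k) (hkp : k ≤ p) :
    ∃ e₁ e₂ : ℤ, c * e₂ - d * e₁ = k ∧ |e₁| ≤ (2 * p / m : ℕ) ∧ |e₂| ≤ (2 * p / m : ℕ) := by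
  rcases le_total d.natAbs c.natAbs with h | h
  · rw [max_eq_left h] at hmax
    exact exists_small_solution_of_abs_le hcd hmax (by omega) hm hm0 hk0 hkp
  · rw [max_eq_right h] at hmax
    obtain ⟨e₁, e₂, h1, h2, h3⟩ := exists_small_solution_of_abs_le (c := -d) (d := -c)
      hcd.symm.neg_neg (by simpa using hmax) (by simp; omega) hm hm0 hk0 hkp
    exact ⟨e₂, e₁, by linarith, h3, h2⟩

/-- Lower bound for the number of points of the lattice `a ≡ r b (mod p)` in a box, in terms of
a primitive vector `(c, d)` of that lattice. -/
theorem card_lattice_box_ge {p : ℕ} (hp : p.Prime) (N : ℕ) {r c d : ℤ} (hcd : IsCoprime c d)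
    (hv : (p : ℤ) ∣ c - r * d) (hm : max c.natAbs d.natAbs ^ 2 ≤ p) :
    (N : ℝ) ^ 2 / p - 8 * N / (max c.natAbs d.natAbs : ℕ) ≤
      (((Finset.Icc 1 N ×ˢ Finset.Icc 1 N).filter
        (fun ab : ℕ × ℕ => (p : ℤ) ∣ (ab.1 : ℤ) - r * ab.2)).card : ℝ) := by
  set m := max c.natAbs d.natAbs with hmdef
  have hm0 : 0 < m := by
    by_contra h
    have h1 : c = 0 := by omega
    have h2 : d = 0 := by omega
    rw [h1, h2] at hcd
    exact not_isCoprime_zero_zero hcd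
  have hp0 : (0 : ℝ) < p := by exact_mod_cast hp.pos
  have hm0' : (0 : ℝ) < m := by exact_mod_cast hm0
  have hpz : Prime (p : ℤ) := Nat.prime_iff_prime_int.mp hp
  have hpd : ¬ (p : ℤ) ∣ d := by
    intro h
    have hc : (p : ℤ) ∣ c := by
      have := dvd_add hv (h.mul_left r)
      simpa using this
    exact hpz.not_isUnit (hcd.isUnit_of_dvd' hc h)
  set D := 2 * p / m with hD
  set L := (Finset.Icc 1 N ×ˢ Finset.Icc 1 N).filter
        (fun ab : ℕ × ℕ => (p : ℤ) ∣ (ab.1 : ℤ) - r * ab.2) with hL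
  have hDle : (D : ℝ) ≤ 2 * p / m := by
    have := @Nat.cast_div_le ℝ _ _ _ (2 * p) m
    push_cast at this
    exact this
  by_cases hND : N < 2 * D
  · have h1 : (N : ℝ) ≤ 2 * D := by exact_mod_cast hND.le
    have h2 : (N : ℝ) ^ 2 / p ≤ 8 * N / m := by
      rw [div_le_div_iff₀ hp0 hm0']
      have h3 : (N : ℝ) * m ≤ 4 * p := by
        have : (N : ℝ) ≤ 4 * p / m := by
          calc (N : ℝ) ≤ 2 * D := h1
            _ ≤ 2 * (2 * p / m) := by gcongr
            _ = 4 * p / m := by ring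
        rwa [le_div_iff₀ hm0'] at this
      have : (0 : ℝ) ≤ N := Nat.cast_nonneg _
      nlinarith
    have : (0 : ℝ) ≤ L.card := Nat.cast_nonneg _
    linarith
  push Not at hND
  have hsol : ∀ k ∈ Finset.range p, ∃ e : ℤ × ℤ, c * e.2 - d * e.1 = k ∧ |e.1| ≤ D ∧ |e.2| ≤ D := by
    intro k hk
    obtain ⟨e₁, e₂, h⟩ := exists_small_solution hcd hmdef.symm hm hm0 (k := k) (by positivity)
      (by have := Finset.mem_range.mp hk; omega)
    exact ⟨(e₁, e₂), h⟩
  choose! e he using hsol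
  have hcard : (N - 2 * D) * (N - 2 * D) ≤ L.card * p := by
    have hbox : (Finset.Ioc D (N - D) ×ˢ Finset.Ioc D (N - D)).card =
        (N - 2 * D) * (N - 2 * D) := by
      rw [Finset.card_product, Nat.card_Ioc]
      congr 1 <;> omega
    rw [← hbox]
    rw [show L.card * p = (L ×ˢ Finset.range p).card by
      rw [Finset.card_product, Finset.card_range]]
    let κ : ℕ × ℕ → ℕ := fun q => ((c * q.2 - d * q.1) % p).toNat
    have hκ : ∀ q, ((κ q : ℕ) : ℤ) = (c * q.2 - d * q.1) % p := fun q =>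
      Int.toNat_of_nonneg (Int.emod_nonneg _ (by exact_mod_cast hp.ne_zero))
    have hκr : ∀ q, κ q ∈ Finset.range p := by
      intro q
      rw [Finset.mem_range]
      have := Int.emod_lt_of_pos (c * q.2 - d * q.1) (by exact_mod_cast hp.pos : (0 : ℤ) < p)
      rw [← hκ] at this
      exact_mod_cast this
    refine Finset.card_le_card_of_injOn
      (fun q => (((q.1 - (e (κ q)).1 : ℤ).toNat, (q.2 - (e (κ q)).2 : ℤ).toNat), κ q)) ?_ ?_
    · intro q hq
      simp only [Finset.coe_product, Set.mem_prod, Finset.mem_coe, Finset.mem_Ioc] at hq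
      obtain ⟨h1, h2, h3⟩ := he _ (hκr q)
      rw [abs_le] at h2 h3
      simp only [Finset.coe_product, Set.mem_prod, Finset.mem_coe]
      refine ⟨?_, hκr q⟩
      rw [hL, Finset.mem_filter, Finset.mem_product, Finset.mem_Icc, Finset.mem_Icc]
      refine ⟨⟨⟨by omega, by omega⟩, ⟨by omega, by omega⟩⟩, ?_⟩
      dsimp only
      rw [Int.toNat_of_nonneg (by omega), Int.toNat_of_nonneg (by omega)]
      have hdvd : (p : ℤ) ∣ c * (q.2 - (e (κ q)).2) - d * (q.1 - (e (κ q)).1) := by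
        have : c * (q.2 - (e (κ q)).2) - d * (q.1 - (e (κ q)).1) =
            (c * q.2 - d * q.1) - (c * q.2 - d * q.1) % p := by
          rw [← hκ]; linear_combination -h1
        rw [this]
        exact Int.dvd_self_sub_emod
      have hmul : (p : ℤ) ∣ d * (q.1 - (e (κ q)).1 - r * (q.2 - (e (κ q)).2)) := by
        have heq : d * (q.1 - (e (κ q)).1 - r * (q.2 - (e (κ q)).2)) =
            (c - r * d) * (q.2 - (e (κ q)).2) -
              (c * (q.2 - (e (κ q)).2) - d * (q.1 - (e (κ q)).1)) := by ring
        rw [heq]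
        exact dvd_sub (hv.mul_right _) hdvd
      exact (hpz.dvd_or_dvd hmul).resolve_left hpd
    · intro q hq q' hq' h
      simp only [Finset.coe_product, Set.mem_prod, Finset.mem_coe, Finset.mem_Ioc] at hq hq'
      simp only [Prod.mk.injEq] at h
      obtain ⟨⟨h1, h2⟩, h3⟩ := h
      obtain ⟨-, h4, h5⟩ := he _ (hκr q)
      obtain ⟨-, h4', h5'⟩ := he _ (hκr q')
      rw [abs_le] at h4 h5 h4' h5'
      rw [h3] at h1 h2 h4 h5
      ext <;> omega
  have hcard' : ((N : ℝ) - 2 * D) * (N - 2 * D) ≤ L.card * p := by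
    have : (((N - 2 * D : ℕ) : ℝ)) = N - 2 * D := by push_cast [Nat.cast_sub hND]; ring
    rw [← this]
    exact_mod_cast hcard
  have h1 : ((N : ℝ) ^ 2 - 4 * N * D) / p ≤ L.card := by
    rw [div_le_iff₀ hp0]; nlinarith
  have h2 : 4 * (N : ℝ) * D / p ≤ 8 * N / m := by
    calc 4 * (N : ℝ) * D / p ≤ 4 * N * (2 * p / m) / p := by gcongr
      _ = 8 * N / m := by field_simp; ring
  rw [sub_div] at h1
  linarith

/-- Thue's lemma, with a primitive solution. -/
theorem exists_coprime_small_congruence {p : ℕ} (hp : p.Prime) (r : ℤ) :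
    ∃ c d : ℤ, IsCoprime c d ∧ (p : ℤ) ∣ c - r * d ∧ max c.natAbs d.natAbs ^ 2 ≤ p := by
  have : NeZero p := ⟨hp.ne_zero⟩
  have hpz : Prime (p : ℤ) := Nat.prime_iff_prime_int.mp hp
  set s := Nat.sqrt p with hs
  have hs1 : s * s ≤ p := Nat.sqrt_le p
  have hs2 : p < (s + 1) * (s + 1) := Nat.lt_succ_sqrt p
  obtain ⟨q, hq, q', hq', hne, heq⟩ := Finset.exists_ne_map_eq_of_card_lt_of_maps_to
    (s := Finset.range (s + 1) ×ˢ Finset.range (s + 1)) (t := (Finset.univ : Finset (ZMod p)))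
    (f := fun q => (q.1 : ZMod p) - r * q.2)
    (by simpa [Finset.card_product, ZMod.card] using hs2) (fun _ _ => Finset.mem_univ _)
  rw [Finset.mem_product, Finset.mem_range, Finset.mem_range] at hq hq'
  set c : ℤ := q.1 - q'.1 with hc
  set d : ℤ := q.2 - q'.2 with hd
  have hdvd : (p : ℤ) ∣ c - r * d := by
    rw [← ZMod.intCast_zmod_eq_zero_iff_dvd, hc, hd]
    push_cast
    linear_combination heq
  have hcd0 : c ≠ 0 ∨ d ≠ 0 := by
    by_contra! h
    exact hne (Prod.ext (by omega) (by omega))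
  have hgpos : 0 < Int.gcd c d := Int.gcd_pos_iff.mpr hcd0
  obtain ⟨g, c', d', hg0, hcop, hc', hd'⟩ := Int.exists_gcd_one' hgpos
  have hc's : c.natAbs ≤ s := by omega
  have hd's : d.natAbs ≤ s := by omega
  have hle : ∀ a : ℤ, a.natAbs ≤ (a * g).natAbs := fun a => by
    rw [Int.natAbs_mul]; exact Nat.le_mul_of_pos_right _ (by simpa using hg0)
  refine ⟨c', d', Int.isCoprime_iff_gcd_eq_one.mpr hcop, ?_, ?_⟩
  · have h1 : (p : ℤ) ∣ (c' - r * d') * g := by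
      rw [hc', hd'] at hdvd
      convert hdvd using 1; ring
    refine (hpz.dvd_or_dvd h1).resolve_right fun h => ?_
    have hpg : p ≤ g := Nat.le_of_dvd hg0 (by exact_mod_cast h)
    have hgs : g ≤ s := by
      rcases hcd0 with h | h
      · have : g ∣ c.natAbs := by rw [hc', Int.natAbs_mul]; simp
        exact (Nat.le_of_dvd (by omega) this).trans hc's
      · have : g ∣ d.natAbs := by rw [hd', Int.natAbs_mul]; simp
        exact (Nat.le_of_dvd (by omega) this).trans hd's
    have := hp.two_le
    nlinarith
  · have h1 := hle c'
    have h2 := hle d'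
    rw [← hc'] at h1
    rw [← hd'] at h2
    have : max c'.natAbs d'.natAbs ≤ s := max_le (h1.trans hc's) (h2.trans hd's)
    calc max c'.natAbs d'.natAbs ^ 2 ≤ s ^ 2 := by gcongr
      _ ≤ p := by rw [sq]; exact hs1

/-- The residues `r` modulo `p` with `p ∣ Φ(r, 1)`. -/
noncomputable def rootsMod (Φ : ℤ → ℤ → ℤ) (p : ℕ) : Finset ℕ :=
  (Finset.range p).filter fun r => (p : ℤ) ∣ Φ r 1

/-- The pairs `1 ≤ a, b ≤ N` with `p ∣ Φ(a, b)`. -/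
noncomputable def boxMultiples (Φ : ℤ → ℤ → ℤ) (N p : ℕ) : Finset (ℕ × ℕ) :=
  (Finset.Icc 1 N ×ˢ Finset.Icc 1 N).filter fun ab => (p : ℤ) ∣ Φ ab.1 ab.2

theorem sum_inv_max_natAbs_le (s : ℕ) :
    ∑ q ∈ (Finset.Icc (-(s : ℤ)) s ×ˢ Finset.Icc (-(s : ℤ)) s).erase (0, 0),
      (1 : ℝ) / (max q.1.natAbs q.2.natAbs : ℕ) ≤ 12 * s := by
  set T := (Finset.Icc (-(s : ℤ)) s ×ˢ Finset.Icc (-(s : ℤ)) s).erase (0, 0) with hT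
  have hmaps : ∀ q ∈ T, max q.1.natAbs q.2.natAbs ∈ Finset.Icc 1 s := by
    intro q hq
    rw [hT, Finset.mem_erase, Finset.mem_product, Finset.mem_Icc, Finset.mem_Icc, Ne,
      Prod.ext_iff] at hq
    rw [Finset.mem_Icc]
    simp only at hq
    omega
  rw [← Finset.sum_fiberwise_of_maps_to hmaps]
  have hj : ∀ j ∈ Finset.Icc 1 s, ∑ q ∈ T with max q.1.natAbs q.2.natAbs = j,
      (1 : ℝ) / (max q.1.natAbs q.2.natAbs : ℕ) ≤ 12 := by
    intro j hj
    have hj1 : 1 ≤ j := (Finset.mem_Icc.mp hj).1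
    have hj0 : (0 : ℝ) < j := by exact_mod_cast hj1
    have h1 : ∑ q ∈ T with max q.1.natAbs q.2.natAbs = j,
        (1 : ℝ) / (max q.1.natAbs q.2.natAbs : ℕ) =
        ∑ q ∈ T with max q.1.natAbs q.2.natAbs = j, (1 : ℝ) / j := by
      refine Finset.sum_congr rfl fun q hq => ?_
      rw [(Finset.mem_filter.mp hq).2]
    rw [h1, Finset.sum_const, nsmul_eq_mul, mul_one_div, div_le_iff₀ hj0]
    have h2 : (T.filter fun q => max q.1.natAbs q.2.natAbs = j) ⊆
        (({(j : ℤ), -(j : ℤ)} : Finset ℤ) ×ˢ Finset.Icc (-(j : ℤ)) j) ∪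
        (Finset.Icc (-(j : ℤ)) j ×ˢ ({(j : ℤ), -(j : ℤ)} : Finset ℤ)) := by
      intro q hq
      have := (Finset.mem_filter.mp hq).2
      simp only [Finset.mem_union, Finset.mem_product, Finset.mem_Icc, Finset.mem_insert,
        Finset.mem_singleton]
      omega
    have h3 := (Finset.card_le_card h2).trans (Finset.card_union_le _ _)
    rw [Finset.card_product, Finset.card_product, Int.card_Icc] at h3
    have h4 : ({(j : ℤ), -(j : ℤ)} : Finset ℤ).card ≤ 2 := Finset.card_le_two
    have h5 : ((j : ℤ) + 1 - -(j : ℤ)).toNat = 2 * j + 1 := by omega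
    rw [h5] at h3
    have h6 : (T.filter fun q => max q.1.natAbs q.2.natAbs = j).card ≤ 12 * j := by nlinarith
    exact_mod_cast h6
  calc _ ≤ ∑ j ∈ Finset.Icc 1 s, (12 : ℝ) := Finset.sum_le_sum hj
    _ = 12 * s := by simp [mul_comm]

theorem sum_log_primeFactors_le {n : ℕ} (hn : n ≠ 0) :
    ∑ p ∈ n.primeFactors, Real.log p ≤ Real.log n := by
  rw [← Real.log_prod (fun p hp => by exact_mod_cast (Nat.prime_of_mem_primeFactors hp).ne_zero)]
  apply Real.log_le_log
  · exact Finset.prod_pos fun p hp => by exact_mod_cast (Nat.prime_of_mem_primeFactors hp).pos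
  · rw [← Nat.cast_prod]
    exact_mod_cast Nat.le_of_dvd (Nat.pos_of_ne_zero hn) (Nat.prod_primeFactors_dvd n)

theorem not_dvd_right_of_isCoprime {p : ℕ} (hp : p.Prime) {r c d : ℤ} (hcd : IsCoprime c d)
    (hv : (p : ℤ) ∣ c - r * d) : ¬ (p : ℤ) ∣ d := by
  intro h
  have hc : (p : ℤ) ∣ c := by
    have := dvd_add hv (h.mul_left r)
    simpa using this
  exact (Nat.prime_iff_prime_int.mp hp).not_isUnit (hcd.isUnit_of_dvd' hc h)

theorem eq_of_dvd_sub_mul {p : ℕ} (hp : p.Prime) {r r' : ℕ} (hr : r < p) (hr' : r' < p) {c d : ℤ}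
    (hd : ¬ (p : ℤ) ∣ d) (h : (p : ℤ) ∣ c - r * d) (h' : (p : ℤ) ∣ c - r' * d) : r = r' := by
  have h1 : (p : ℤ) ∣ ((r' : ℤ) - r) * d := by
    rw [show ((r' : ℤ) - r) * d = (c - r * d) - (c - r' * d) by ring]
    exact dvd_sub h h'
  have h2 := ((Nat.prime_iff_prime_int.mp hp).dvd_or_dvd h1).resolve_right hd
  have h3 := Int.eq_zero_of_abs_lt_dvd h2 (by rw [abs_lt]; omega)
  omega

theorem sum_log_div_max_le {Φ : ℤ → ℤ → ℤ} (hΦ0 : ∀ a b, Φ a b = 0 → a = 0 ∧ b = 0)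
    (hΦdvd : ∀ p a b r : ℤ, p ∣ a - r * b → p ∣ Φ r 1 → p ∣ Φ a b)
    {s : ℕ} {W : ℝ} (hW0 : 0 ≤ W)
    (hW : ∀ c d : ℤ, c.natAbs ≤ s → d.natAbs ≤ s → Real.log (Φ c d).natAbs ≤ W)
    (S : Finset ℕ) (hS : ∀ p ∈ S, p.Prime ∧ p ≤ s ^ 2) (v : ℕ → ℕ → ℤ × ℤ)
    (hv : ∀ p ∈ S, ∀ r ∈ rootsMod Φ p, IsCoprime (v p r).1 (v p r).2 ∧
      (p : ℤ) ∣ (v p r).1 - r * (v p r).2 ∧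
      max (v p r).1.natAbs (v p r).2.natAbs ^ 2 ≤ p) :
    ∑ p ∈ S, ∑ r ∈ rootsMod Φ p,
      Real.log p / (max (v p r).1.natAbs (v p r).2.natAbs : ℕ) ≤ 12 * s * W := by
  set T := (Finset.Icc (-(s : ℤ)) s ×ˢ Finset.Icc (-(s : ℤ)) s).erase (0, 0) with hT
  let G : (Σ _ : ℤ × ℤ, ℕ) → ℝ := fun x => Real.log x.2 / (max x.1.1.natAbs x.1.2.natAbs : ℕ)
  let i : (Σ _ : ℕ, ℕ) → (Σ _ : ℤ × ℤ, ℕ) := fun x => ⟨v x.1 x.2, x.1⟩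
  have hinj : Set.InjOn i (S.sigma fun p => rootsMod Φ p) := by
    rintro ⟨p, r⟩ hx ⟨p', r'⟩ hx' h
    simp only [Finset.coe_sigma, Set.mem_sigma_iff, Finset.mem_coe] at hx hx'
    simp only [i, Sigma.mk.injEq, heq_eq_eq] at h
    obtain ⟨h1, rfl⟩ := h
    obtain ⟨hc, hd, -⟩ := hv p hx.1 r hx.2
    obtain ⟨-, hd', -⟩ := hv p hx'.1 r' hx'.2
    rw [← h1] at hd'
    have hp := (hS p hx.1).1
    have := eq_of_dvd_sub_mul hp (Finset.mem_range.mp (Finset.mem_filter.mp hx.2).1)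
      (Finset.mem_range.mp (Finset.mem_filter.mp hx'.2).1)
      (not_dvd_right_of_isCoprime hp hc hd) hd hd'
    rw [this]
  have hsub : (S.sigma fun p => rootsMod Φ p).image i ⊆
      T.sigma fun q => (Φ q.1 q.2).natAbs.primeFactors := by
    intro x hx
    obtain ⟨⟨p, r⟩, hpr, rfl⟩ := Finset.mem_image.mp hx
    simp only [Finset.mem_sigma] at hpr
    obtain ⟨hc, hd, hm⟩ := hv p hpr.1 r hpr.2
    obtain ⟨hp, hps⟩ := hS p hpr.1
    have hms : max (v p r).1.natAbs (v p r).2.natAbs ≤ s :=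
      (Nat.pow_le_pow_iff_left two_ne_zero).mp (hm.trans hps)
    have hne : ¬ ((v p r).1 = 0 ∧ (v p r).2 = 0) := by
      rintro ⟨h1, h2⟩
      rw [h1, h2] at hc
      exact not_isCoprime_zero_zero hc
    simp only [i, Finset.mem_sigma]
    refine ⟨?_, ?_⟩
    · rw [hT, Finset.mem_erase, Finset.mem_product, Finset.mem_Icc, Finset.mem_Icc, Ne,
        Prod.ext_iff]
      refine ⟨hne, ?_⟩
      omega
    · rw [Nat.mem_primeFactors]
      refine ⟨hp, ?_, ?_⟩
      · rw [← Int.natCast_dvd]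
        exact hΦdvd _ _ _ _ hd (Finset.mem_filter.mp hpr.2).2
      · rw [Ne, Int.natAbs_eq_zero]
        exact fun h => hne (hΦ0 _ _ h)
  calc _ = ∑ x ∈ S.sigma fun p => rootsMod Φ p, G (i x) := by
        rw [Finset.sum_sigma]
    _ = ∑ x ∈ (S.sigma fun p => rootsMod Φ p).image i, G x := (Finset.sum_image hinj).symm
    _ ≤ ∑ x ∈ T.sigma fun q => (Φ q.1 q.2).natAbs.primeFactors, G x := by
        refine Finset.sum_le_sum_of_subset_of_nonneg hsub fun x hx _ => ?_
        exact div_nonneg (Real.log_natCast_nonneg _) (Nat.cast_nonneg _)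
    _ = ∑ q ∈ T, (1 / (max q.1.natAbs q.2.natAbs : ℕ)) *
          ∑ p ∈ (Φ q.1 q.2).natAbs.primeFactors, Real.log p := by
        rw [Finset.sum_sigma]
        refine Finset.sum_congr rfl fun q _ => ?_
        rw [Finset.mul_sum]
        refine Finset.sum_congr rfl fun p _ => ?_
        simp only [G]
        ring
    _ ≤ ∑ q ∈ T, ((1 : ℝ) / (max q.1.natAbs q.2.natAbs : ℕ)) * W := by
        refine Finset.sum_le_sum fun q hq => ?_
        rw [hT, Finset.mem_erase, Finset.mem_product, Finset.mem_Icc, Finset.mem_Icc, Ne,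
          Prod.ext_iff] at hq
        refine mul_le_mul_of_nonneg_left ?_ (by positivity)
        refine (sum_log_primeFactors_le ?_).trans (hW _ _ (by omega) (by omega))
        rw [Ne, Int.natAbs_eq_zero]
        exact fun h => hq.1 (hΦ0 _ _ h)
    _ = (∑ q ∈ T, (1 : ℝ) / (max q.1.natAbs q.2.natAbs : ℕ)) * W := by rw [Finset.sum_mul]
    _ ≤ 12 * s * W := by
        gcongr
        exact sum_inv_max_natAbs_le s

theorem sum_card_lattice_box_le {Φ : ℤ → ℤ → ℤ}
    (hΦdvd : ∀ p a b r : ℤ, p ∣ a - r * b → p ∣ Φ r 1 → p ∣ Φ a b)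
    {p : ℕ} (hp : p.Prime) (N : ℕ) :
    ∑ r ∈ rootsMod Φ p, (((Finset.Icc 1 N ×ˢ Finset.Icc 1 N).filter
        (fun ab : ℕ × ℕ => (p : ℤ) ∣ (ab.1 : ℤ) - r * ab.2)).card : ℝ) ≤
      (boxMultiples Φ N p).card + (rootsMod Φ p).card * ((N : ℝ) / p) ^ 2 := by
  have hpz := Nat.prime_iff_prime_int.mp hp
  set Q := Finset.Icc 1 N ×ˢ Finset.Icc 1 N with hQ
  set Z := Q.filter fun ab : ℕ × ℕ => p ∣ ab.1 ∧ p ∣ ab.2 with hZ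
  have hZcard : Z.card ≤ (N / p) * (N / p) := by
    have h1 : Z = (Finset.Ioc 0 N).filter (p ∣ ·) ×ˢ (Finset.Ioc 0 N).filter (p ∣ ·) := by
      ext ⟨a, b⟩
      simp only [hZ, hQ, Finset.mem_filter, Finset.mem_product, Finset.mem_Icc, Finset.mem_Ioc]
      constructor
      · rintro ⟨⟨⟨h1, h2⟩, h3, h4⟩, h5, h6⟩
        exact ⟨⟨⟨by omega, h2⟩, h5⟩, ⟨by omega, h4⟩, h6⟩
      · rintro ⟨⟨⟨h1, h2⟩, h5⟩, ⟨h3, h4⟩, h6⟩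
        exact ⟨⟨⟨by omega, h2⟩, by omega, h4⟩, h5, h6⟩
    have h2 := Nat.Ioc_filter_dvd_card_eq_div N p
    rw [h1, Finset.card_product]
    refine le_of_eq ?_
    rw [h2]
  have hpt : ∀ ab ∈ Q, ((rootsMod Φ p).filter
      fun r : ℕ => (p : ℤ) ∣ (ab.1 : ℤ) - r * ab.2).card ≤
      (if (p : ℤ) ∣ Φ ab.1 ab.2 then 1 else 0) +
      (if p ∣ ab.1 ∧ p ∣ ab.2 then (rootsMod Φ p).card else 0) := by
    intro ab _
    by_cases hb : p ∣ ab.2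
    · by_cases ha : p ∣ ab.1
      · have hab : p ∣ ab.1 ∧ p ∣ ab.2 := ⟨ha, hb⟩
        rw [if_pos hab]
        exact (Finset.card_filter_le _ _).trans (Nat.le_add_left _ _)
      · rw [Finset.filter_false_of_mem]
        · simp
        · intro r _ h
          have hb' : (p : ℤ) ∣ r * (ab.2 : ℤ) := (Int.natCast_dvd_natCast.mpr hb).mul_left _
          have := dvd_add h hb'
          rw [sub_add_cancel] at this
          exact ha (Int.natCast_dvd_natCast.mp this)
    · have hb' : ¬ (p : ℤ) ∣ (ab.2 : ℤ) := fun h => hb (Int.natCast_dvd_natCast.mp h)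
      rcases Finset.eq_empty_or_nonempty ((rootsMod Φ p).filter
        fun r : ℕ => (p : ℤ) ∣ (ab.1 : ℤ) - r * ab.2) with h | ⟨r, hr⟩
      · rw [h]; simp
      · rw [Finset.mem_filter] at hr
        rw [if_pos (hΦdvd _ _ _ _ hr.2 (Finset.mem_filter.mp hr.1).2)]
        refine le_trans ?_ (Nat.le_add_right _ _)
        rw [Finset.card_le_one]
        intro x hx y hy
        rw [Finset.mem_filter] at hx hy
        exact eq_of_dvd_sub_mul hp (Finset.mem_range.mp (Finset.mem_filter.mp hx.1).1)
          (Finset.mem_range.mp (Finset.mem_filter.mp hy.1).1) hb' hx.2 hy.2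
  have hsum : ∑ r ∈ rootsMod Φ p, (Q.filter
        (fun ab : ℕ × ℕ => (p : ℤ) ∣ (ab.1 : ℤ) - r * ab.2)).card ≤
      (boxMultiples Φ N p).card + (rootsMod Φ p).card * Z.card := by
    calc _ = ∑ ab ∈ Q, ((rootsMod Φ p).filter
          fun r : ℕ => (p : ℤ) ∣ (ab.1 : ℤ) - r * ab.2).card := by
          simp only [Finset.card_filter]
          exact Finset.sum_comm
      _ ≤ _ := Finset.sum_le_sum hpt
      _ = _ := by
          rw [Finset.sum_add_distrib, boxMultiples, Finset.card_filter,
            ← Finset.sum_filter (fun ab : ℕ × ℕ => p ∣ ab.1 ∧ p ∣ ab.2),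
            ← hZ, Finset.sum_const, smul_eq_mul, mul_comm (Z.card)]
  have hdiv : ((N / p : ℕ) : ℝ) ≤ (N : ℝ) / p := Nat.cast_div_le
  calc _ ≤ ((boxMultiples Φ N p).card : ℝ) + (rootsMod Φ p).card * Z.card := by exact_mod_cast hsum
    _ ≤ _ := by
        gcongr
        calc (Z.card : ℝ) ≤ ((N / p : ℕ) : ℝ) * ((N / p : ℕ) : ℝ) := by exact_mod_cast hZcard
          _ ≤ ((N : ℝ) / p) * ((N : ℝ) / p) := by gcongr
          _ = _ := by ring

/-- Level of distribution `N²` for the divisibility of `Φ(a, b)` by primes. -/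
theorem sum_log_mul_card_boxMultiples_ge {Φ : ℤ → ℤ → ℤ}
    (hΦ0 : ∀ a b, Φ a b = 0 → a = 0 ∧ b = 0)
    (hΦdvd : ∀ p a b r : ℤ, p ∣ a - r * b → p ∣ Φ r 1 → p ∣ Φ a b)
    {s t : ℕ} {W : ℝ} (hW0 : 0 ≤ W)
    (hW : ∀ c d : ℤ, c.natAbs ≤ s → d.natAbs ≤ s → Real.log (Φ c d).natAbs ≤ W)
    (S : Finset ℕ) (hS : ∀ p ∈ S, p.Prime ∧ p ≤ s ^ 2)
    (ht : ∀ p ∈ S, (rootsMod Φ p).card ≤ t) (N : ℕ) :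
    (N : ℝ) ^ 2 * ∑ p ∈ S, (rootsMod Φ p).card * (Real.log p / p) ≤
      ∑ p ∈ S, Real.log p * (boxMultiples Φ N p).card + 96 * N * s * W +
        t * N ^ 2 * ∑ p ∈ S, Real.log p / (p : ℝ) ^ 2 := by
  have hex : ∀ p ∈ S, ∀ r : ℕ, ∃ v : ℤ × ℤ, IsCoprime v.1 v.2 ∧ (p : ℤ) ∣ v.1 - r * v.2 ∧
      max v.1.natAbs v.2.natAbs ^ 2 ≤ p := fun p hp r => by
    obtain ⟨c, d, h⟩ := exists_coprime_small_congruence (hS p hp).1 r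
    exact ⟨(c, d), h⟩
  choose! v hv using hex
  have herr := sum_log_div_max_le hΦ0 hΦdvd hW0 hW S hS v fun p hp r _ => hv p hp r
  have hmain : ∀ p ∈ S, (N : ℝ) ^ 2 * ((rootsMod Φ p).card * (Real.log p / p)) ≤
      Real.log p * (boxMultiples Φ N p).card + 8 * N * ∑ r ∈ rootsMod Φ p,
        Real.log p / (max (v p r).1.natAbs (v p r).2.natAbs : ℕ) +
      t * N ^ 2 * (Real.log p / (p : ℝ) ^ 2) := by
    intro p hp
    have hlog : 0 ≤ Real.log p := Real.log_natCast_nonneg p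
    have h1 : ∑ r ∈ rootsMod Φ p, ((N : ℝ) ^ 2 / p -
        8 * N / (max (v p r).1.natAbs (v p r).2.natAbs : ℕ)) ≤ _ :=
      (Finset.sum_le_sum fun r _ => card_lattice_box_ge (hS p hp).1 N (hv p hp r).1
        (hv p hp r).2.1 (hv p hp r).2.2).trans (sum_card_lattice_box_le hΦdvd (hS p hp).1 N)
    have h2 : ((rootsMod Φ p).card : ℝ) * ((N : ℝ) / p) ^ 2 ≤ t * ((N : ℝ) / p) ^ 2 := by
      gcongr
      exact_mod_cast ht p hp
    have h3 := mul_le_mul_of_nonneg_left (h1.trans (add_le_add_right h2 _)) hlog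
    rw [Finset.sum_sub_distrib, Finset.sum_const, nsmul_eq_mul] at h3
    have h4 : Real.log p * ∑ r ∈ rootsMod Φ p,
        8 * (N : ℝ) / (max (v p r).1.natAbs (v p r).2.natAbs : ℕ) =
        8 * N * ∑ r ∈ rootsMod Φ p,
        Real.log p / (max (v p r).1.natAbs (v p r).2.natAbs : ℕ) := by
      rw [Finset.mul_sum, Finset.mul_sum]
      refine Finset.sum_congr rfl fun r _ => ?_
      ring
    rw [mul_sub, h4] at h3
    have h5 : Real.log p * (t * ((N : ℝ) / p) ^ 2) = t * N ^ 2 * (Real.log p / (p : ℝ) ^ 2) := by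
      rw [div_pow]; ring
    have h6 : Real.log p * ((rootsMod Φ p).card * ((N : ℝ) ^ 2 / p)) =
        (N : ℝ) ^ 2 * ((rootsMod Φ p).card * (Real.log p / p)) := by ring
    rw [mul_add, h5, h6] at h3
    linarith
  rw [Finset.mul_sum]
  refine (Finset.sum_le_sum hmain).trans ?_
  rw [Finset.sum_add_distrib, Finset.sum_add_distrib, ← Finset.mul_sum, ← Finset.mul_sum]
  have : 8 * (N : ℝ) * ∑ p ∈ S, ∑ r ∈ rootsMod Φ p,
      Real.log p / (max (v p r).1.natAbs (v p r).2.natAbs : ℕ) ≤ 8 * N * (12 * s * W) := by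
    gcongr
  linarith

section NumberFieldMertens

open NumberField Ideal Filter Topology UniqueFactorizationMonoid

theorem exists_sum_log_div_sq_le :
    ∃ E : ℝ, 0 ≤ E ∧ ∀ S : Finset ℕ, ∑ n ∈ S, Real.log n / (n : ℝ) ^ 2 ≤ E := by
  have hsum : Summable fun n : ℕ => 2 * (1 / (n : ℝ) ^ (3 / 2 : ℝ)) :=
    (Real.summable_one_div_nat_rpow.mpr (by norm_num)).mul_left 2
  have hle : ∀ n : ℕ, Real.log n / (n : ℝ) ^ 2 ≤ 2 * (1 / (n : ℝ) ^ (3 / 2 : ℝ)) := by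
    intro n
    rcases Nat.eq_zero_or_pos n with rfl | hn
    · simp
    have hn' : (0 : ℝ) < n := by exact_mod_cast hn
    have h1 := Real.log_le_rpow_div hn'.le (show (0 : ℝ) < 1 / 2 by norm_num)
    have h2 : (n : ℝ) ^ 2 = (n : ℝ) ^ (1 / 2 : ℝ) * (n : ℝ) ^ (3 / 2 : ℝ) := by
      rw [← Real.rpow_add hn', ← Real.rpow_natCast]; norm_num
    rw [mul_one_div, h2, div_le_div_iff₀ (by positivity) (by positivity)]
    have h3 : 0 < (n : ℝ) ^ (3 / 2 : ℝ) := by positivity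
    nlinarith
  refine ⟨∑' n : ℕ, 2 * (1 / (n : ℝ) ^ (3 / 2 : ℝ)), tsum_nonneg fun n => by positivity,
    fun S => ?_⟩
  exact (Finset.sum_le_sum fun n _ => hle n).trans
    (hsum.sum_le_tsum S fun n _ => by positivity)

variable (K : Type*) [Field K] [NumberField K]

/-- The nonzero integral ideals of norm at most `n`. -/
noncomputable def idealsLE (n : ℕ) : Finset (Ideal (𝓞 K)) :=
  (finite_setOfPred_absNorm_le (S := 𝓞 K) n).toFinset.erase ⊥

/-- The nonzero prime ideals of norm at most `n`. -/
noncomputable def primeIdealsLE (n : ℕ) : Finset (Ideal (𝓞 K)) :=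
  (idealsLE K n).filter fun P => P.IsPrime

variable {K}

theorem mem_idealsLE {n : ℕ} {I : Ideal (𝓞 K)} : I ∈ idealsLE K n ↔ I ≠ ⊥ ∧ absNorm I ≤ n := by
  simp [idealsLE]

theorem mem_primeIdealsLE {n : ℕ} {P : Ideal (𝓞 K)} :
    P ∈ primeIdealsLE K n ↔ P ≠ ⊥ ∧ absNorm P ≤ n ∧ P.IsPrime := by
  simp [primeIdealsLE, mem_idealsLE, and_assoc]

theorem two_le_absNorm {P : Ideal (𝓞 K)} (hP0 : P ≠ ⊥) (hP : P ≠ ⊤) : 2 ≤ absNorm P := by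
  have h1 : absNorm P ≠ 0 := mt absNorm_eq_zero_iff.mp hP0
  have h2 : absNorm P ≠ 1 := mt absNorm_eq_one_iff.mp hP
  omega

variable (K) in
theorem tendsto_card_idealsLE_div :
    Tendsto (fun n : ℕ => ((idealsLE K n).card : ℝ) / n) atTop (𝓝 (dedekindZeta_residue K)) := by
  have h := (Ideal.tendsto_norm_le_div_atTop K).comp tendsto_natCast_atTop_atTop
  have h' := h.sub (tendsto_inv_atTop_nhds_zero_nat (𝕜 := ℝ))
  rw [sub_zero] at h'
  refine h'.congr fun n => ?_
  simp only [Function.comp_apply, Nat.cast_le]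
  have hcard : Nat.card {I : Ideal (𝓞 K) // absNorm I ≤ n} = (idealsLE K n).card + 1 := by
    rw [idealsLE, Finset.card_erase_add_one (by simp)]
    exact Nat.card_eq_card_finite_toFinset (finite_setOfPred_absNorm_le (S := 𝓞 K) n)
  rw [hcard]
  push_cast
  ring

variable (K) in
theorem exists_card_idealsLE_le_mul :
    ∃ C : ℝ, 0 < C ∧ ∀ n : ℕ, ((idealsLE K n).card : ℝ) ≤ C * n := by
  obtain ⟨C, hC⟩ := (tendsto_card_idealsLE_div K).bddAbove_range
  refine ⟨max C 1, by positivity, fun n => ?_⟩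
  rcases Nat.eq_zero_or_pos n with rfl | hn
  · have : idealsLE K 0 = ∅ := by
      ext I
      simp only [mem_idealsLE, Nat.le_zero, absNorm_eq_zero_iff]
      simp
    simp [this]
  · have hn' : (0 : ℝ) < n := by exact_mod_cast hn
    rw [← div_le_iff₀ hn']
    exact (hC ⟨n, rfl⟩).trans (le_max_left _ _)

theorem card_filter_dvd_idealsLE_le (X : ℕ) {J : Ideal (𝓞 K)} (hJ : J ≠ ⊥) :
    ((idealsLE K X).filter fun I => J ∣ I).card ≤ (idealsLE K (X / absNorm J)).card := by
  have hJ0 : 0 < absNorm J := Nat.pos_of_ne_zero (mt absNorm_eq_zero_iff.mp hJ)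
  refine (Finset.card_le_card (t := (idealsLE K (X / absNorm J)).image (J * ·)) ?_).trans
    Finset.card_image_le
  intro I hI
  rw [Finset.mem_filter, mem_idealsLE] at hI
  obtain ⟨⟨hI0, hIX⟩, L, rfl⟩ := hI
  refine Finset.mem_image.mpr ⟨L, mem_idealsLE.mpr ⟨?_, ?_⟩, rfl⟩
  · rintro rfl
    exact hI0 (by simp)
  · rw [Nat.le_div_iff_mul_le hJ0, mul_comm, ← map_mul]
    exact hIX

theorem log_absNorm_le {X : ℕ} {I : Ideal (𝓞 K)} (hI : I ∈ idealsLE K X) :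
    Real.log (absNorm I) ≤ ∑ P ∈ primeIdealsLE K X,
      (((Finset.range (X + 1)).filter fun k => P ^ (k + 1) ∣ I).card : ℝ) *
        Real.log (absNorm P) := by
  obtain ⟨hI0, hIX⟩ := mem_idealsLE.mp hI
  set m := normalizedFactors I with hm
  have hprod : m.prod = I := Ideal.prod_normalizedFactors_eq_self hI0
  have hprime : ∀ P ∈ m.toFinset, Prime P := fun P hP =>
    prime_of_normalized_factor P (Multiset.mem_toFinset.mp hP)
  have hnorm : absNorm I = ∏ P ∈ m.toFinset, absNorm P ^ m.count P := by
    conv_lhs => rw [← hprod]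
    rw [map_multiset_prod, Finset.prod_multiset_map_count]
  have hpowdvd : ∀ P k, k ≤ m.count P → P ^ k ∣ I := by
    intro P k hk
    rw [← hprod, ← Multiset.prod_replicate]
    exact Multiset.prod_dvd_prod_of_le (Multiset.le_count_iff_replicate_le.mp hk)
  have hIpos : 0 < absNorm I := Nat.pos_of_ne_zero (mt absNorm_eq_zero_iff.mp hI0)
  have hle : ∀ P ∈ m.toFinset, absNorm P ≤ X := fun P hP => by
    have h1 : P ∣ I := dvd_of_mem_normalizedFactors (Multiset.mem_toFinset.mp hP)
    exact (Nat.le_of_dvd hIpos (map_dvd absNorm h1)).trans hIX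
  have htwo : ∀ P ∈ m.toFinset, 2 ≤ absNorm P := fun P hP =>
    two_le_absNorm (hprime P hP).ne_zero fun h => (hprime P hP).not_isUnit (by simp [h])
  have hsub : m.toFinset ⊆ primeIdealsLE K X := fun P hP =>
    mem_primeIdealsLE.mpr ⟨(hprime P hP).ne_zero, hle P hP, isPrime_of_prime (hprime P hP)⟩
  have hcount : ∀ P ∈ m.toFinset,
      m.count P ≤ ((Finset.range (X + 1)).filter fun k => P ^ (k + 1) ∣ I).card := by
    intro P hP
    have hcX : m.count P ≤ X := by
      have h1 : absNorm P ^ m.count P ≤ absNorm I := by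
        rw [← map_pow]
        exact Nat.le_of_dvd hIpos (map_dvd absNorm (hpowdvd P _ le_rfl))
      have h2 : 2 ^ m.count P ≤ absNorm P ^ m.count P := Nat.pow_le_pow_left (htwo P hP) _
      exact (Nat.lt_two_pow_self.le.trans h2).trans (h1.trans hIX)
    calc m.count P = (Finset.range (m.count P)).card := (Finset.card_range _).symm
      _ ≤ _ := by
        refine Finset.card_le_card fun k hk => ?_
        rw [Finset.mem_range] at hk
        rw [Finset.mem_filter, Finset.mem_range]
        exact ⟨by omega, hpowdvd P _ hk⟩
  calc Real.log (absNorm I) = ∑ P ∈ m.toFinset, (m.count P : ℝ) * Real.log (absNorm P) := by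
        rw [hnorm]
        push_cast
        rw [Real.log_prod]
        · simp [Real.log_pow]
        · intro P hP
          have := htwo P hP
          positivity
    _ ≤ ∑ P ∈ m.toFinset, (((Finset.range (X + 1)).filter fun k => P ^ (k + 1) ∣ I).card : ℝ) *
        Real.log (absNorm P) := by
        refine Finset.sum_le_sum fun P hP => ?_
        have := hcount P hP
        have h0 := Real.log_natCast_nonneg (absNorm P)
        gcongr
    _ ≤ _ := Finset.sum_le_sum_of_subset_of_nonneg hsub fun P _ _ =>
        mul_nonneg (Nat.cast_nonneg _) (Real.log_natCast_nonneg _)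

theorem sum_log_absNorm_le (X : ℕ) :
    ∑ I ∈ idealsLE K X, Real.log (absNorm I) ≤
      ∑ P ∈ primeIdealsLE K X, Real.log (absNorm P) *
        ∑ k ∈ Finset.range (X + 1), ((idealsLE K (X / absNorm P ^ (k + 1))).card : ℝ) := by
  calc _ ≤ ∑ I ∈ idealsLE K X, ∑ P ∈ primeIdealsLE K X,
        (((Finset.range (X + 1)).filter fun k => P ^ (k + 1) ∣ I).card : ℝ) *
        Real.log (absNorm P) := Finset.sum_le_sum fun I hI => log_absNorm_le hI
    _ = ∑ P ∈ primeIdealsLE K X, Real.log (absNorm P) * ∑ k ∈ Finset.range (X + 1),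
        (((idealsLE K X).filter fun I => P ^ (k + 1) ∣ I).card : ℝ) := by
        rw [Finset.sum_comm]
        refine Finset.sum_congr rfl fun P _ => ?_
        rw [← Finset.sum_mul, mul_comm]
        congr 1
        simp only [Finset.card_filter, Nat.cast_sum]
        exact Finset.sum_comm
    _ ≤ _ := by
        refine Finset.sum_le_sum fun P hP => ?_
        refine mul_le_mul_of_nonneg_left ?_ (Real.log_natCast_nonneg _)
        refine Finset.sum_le_sum fun k _ => ?_
        rw [← map_pow]
        exact_mod_cast card_filter_dvd_idealsLE_le X
          (pow_ne_zero _ (mem_primeIdealsLE.mp hP).1 : P ^ (k + 1) ≠ 0)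

theorem exists_absNorm_eq_minFac_pow {P : Ideal (𝓞 K)} (hP0 : P ≠ ⊥) (hP : P.IsPrime) :
    (absNorm P).minFac.Prime ∧ ((absNorm P).minFac : 𝓞 K) ∈ P ∧
      ∃ f, 0 < f ∧ f ≤ Module.finrank ℚ K ∧ absNorm P = (absNorm P).minFac ^ f := by
  have := hP.isMaximal hP0
  obtain ⟨p, f, hf, hmem, hp, hN⟩ := exists_prime_and_absNorm_eq_pow P
  have hmin : (absNorm P).minFac = p := by rw [hN, hp.pow_minFac hf.ne']
  rw [hmin]
  refine ⟨hp, hmem, f, hf, ?_, hN⟩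
  have h1 : absNorm P ∣ absNorm (span {(p : 𝓞 K)}) :=
    absNorm_dvd_absNorm_of_le ((span_singleton_le_iff_mem P).mpr hmem)
  rw [absNorm_span_natCast, hN, RingOfIntegers.rank] at h1
  exact (Nat.pow_dvd_pow_iff_le_right hp.one_lt).mp h1

theorem card_le_finrank_of_minFac_absNorm_eq {p : ℕ} (T : Finset (Ideal (𝓞 K)))
    (hT : ∀ P ∈ T, P ≠ ⊥ ∧ P.IsPrime ∧ (absNorm P).minFac = p) :
    T.card ≤ Module.finrank ℚ K := by
  rcases T.eq_empty_or_nonempty with rfl | ⟨P₀, hP₀⟩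
  · simp
  have hp : p.Prime := by
    obtain ⟨h0, h1, h2⟩ := hT P₀ hP₀
    exact h2 ▸ (exists_absNorm_eq_minFac_pow h0 h1).1
  have h1 : ∏ P ∈ T, P ∣ span {(p : 𝓞 K)} := by
    refine Finset.prod_primes_dvd _ (fun P hP => ?_) fun P hP => ?_
    · exact (prime_iff_isPrime (hT P hP).1).mpr (hT P hP).2.1
    · obtain ⟨h0, h1, h2⟩ := hT P hP
      rw [Ideal.dvd_span_singleton, ← h2]
      exact (exists_absNorm_eq_minFac_pow h0 h1).2.1
  have h2 := map_dvd absNorm h1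
  rw [absNorm_span_natCast, map_prod, RingOfIntegers.rank] at h2
  have h3 : p ^ T.card ∣ ∏ P ∈ T, absNorm P := by
    rw [← Finset.prod_const]
    exact Finset.prod_dvd_prod_of_dvd _ _ fun P hP => (hT P hP).2.2 ▸ Nat.minFac_dvd _
  exact (Nat.pow_dvd_pow_iff_le_right hp.one_lt).mp (h3.trans h2)

theorem sum_minFac_absNorm_le {X : ℕ} (T : Finset (Ideal (𝓞 K))) (hT : T ⊆ primeIdealsLE K X)
    (h : ℕ → ℝ) (h0 : ∀ n, 0 ≤ h n) :
    ∑ P ∈ T, h (absNorm P).minFac ≤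
      Module.finrank ℚ K * ∑ p ∈ Nat.primesLE X, h p := by
  have hmaps : ∀ P ∈ T, (absNorm P).minFac ∈ Nat.primesLE X := by
    intro P hP
    obtain ⟨h0, h1, h2⟩ := mem_primeIdealsLE.mp (hT hP)
    have h3 := (exists_absNorm_eq_minFac_pow h0 h2).1
    rw [Nat.mem_primesLE]
    exact ⟨(Nat.minFac_le (Nat.pos_of_ne_zero (mt absNorm_eq_zero_iff.mp h0))).trans h1, h3⟩
  rw [← Finset.sum_fiberwise_of_maps_to hmaps, Finset.mul_sum]
  refine Finset.sum_le_sum fun p _ => ?_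
  have : ∑ P ∈ T with (absNorm P).minFac = p, h (absNorm P).minFac =
      ∑ P ∈ T with (absNorm P).minFac = p, h p :=
    Finset.sum_congr rfl fun P hP => by rw [(Finset.mem_filter.mp hP).2]
  rw [this, Finset.sum_const, nsmul_eq_mul]
  refine mul_le_mul_of_nonneg_right ?_ (h0 p)
  refine Nat.cast_le.mpr (card_le_finrank_of_minFac_absNorm_eq (p := p) _ fun P hP => ?_)
  rw [Finset.mem_filter] at hP
  obtain ⟨h0, -, h2⟩ := mem_primeIdealsLE.mp (hT hP.1)
  exact ⟨h0, h2, hP.2⟩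

variable (K) in
/-- The prime ideals whose norm is a rational prime at most `n`. -/
noncomputable def degreeOnePrimesLE (n : ℕ) : Finset (Ideal (𝓞 K)) :=
  (primeIdealsLE K n).filter fun P => (absNorm P).Prime

theorem sum_card_idealsLE_div_pow_le {C : ℝ} (hC0 : 0 < C)
    (hC : ∀ n : ℕ, ((idealsLE K n).card : ℝ) ≤ C * n) (X : ℕ) {q : ℕ} (hq : 2 ≤ q) :
    ∑ k ∈ Finset.range (X + 1), ((idealsLE K (X / q ^ (k + 1))).card : ℝ) ≤
      (idealsLE K (X / q)).card + 2 * C * X / (q : ℝ) ^ 2 := by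
  rw [Finset.sum_range_succ', zero_add, pow_one, add_comm]
  have hq0 : (0 : ℝ) < q := by positivity
  have h1 : ∀ k ∈ Finset.range X, ((idealsLE K (X / q ^ (k + 1 + 1))).card : ℝ) ≤
      C * X / (q : ℝ) ^ 2 * (1 / 2) ^ k := by
    intro k _
    calc ((idealsLE K (X / q ^ (k + 1 + 1))).card : ℝ) ≤ C * (X / q ^ (k + 1 + 1) : ℕ) := hC _
      _ ≤ C * ((X : ℝ) / (q ^ (k + 1 + 1) : ℕ)) := by
          gcongr
          exact Nat.cast_div_le
      _ = C * X / (q : ℝ) ^ 2 * (1 / q) ^ k := by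
          push_cast
          rw [one_div, inv_pow]
          field_simp
          ring
      _ ≤ C * X / (q : ℝ) ^ 2 * (1 / 2) ^ k := by
          gcongr
          exact_mod_cast hq
  refine add_le_add_right ((Finset.sum_le_sum h1).trans ?_) _
  rw [← Finset.mul_sum]
  calc _ ≤ C * X / (q : ℝ) ^ 2 * 2 := by
        gcongr
        exact sum_geometric_two_le X
    _ = _ := by ring

theorem log_mul_sum_card_le {C : ℝ} (hC0 : 0 < C)
    (hC : ∀ n : ℕ, ((idealsLE K n).card : ℝ) ≤ C * n) (X : ℕ) {P : Ideal (𝓞 K)}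
    (hP : P ∈ primeIdealsLE K X) :
    Real.log (absNorm P) *
        ∑ k ∈ Finset.range (X + 1), ((idealsLE K (X / absNorm P ^ (k + 1))).card : ℝ) ≤
      (if (absNorm P).Prime then
        Real.log (absNorm P) * ((idealsLE K (X / absNorm P)).card : ℝ) else 0) +
      2 * C * X * Module.finrank ℚ K *
        (Real.log (absNorm P).minFac / ((absNorm P).minFac : ℝ) ^ 2) := by
  obtain ⟨hP0, -, hPp⟩ := mem_primeIdealsLE.mp hP
  obtain ⟨hp, -, f, hf0, hfn, hN⟩ := exists_absNorm_eq_minFac_pow hP0 hPp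
  set q := absNorm P with hq
  set p := q.minFac with hpdef
  set n := Module.finrank ℚ K with hn
  have hq2 : 2 ≤ q := two_le_absNorm hP0 hPp.ne_top
  have hp0 : (0 : ℝ) < p := by exact_mod_cast hp.pos
  have hq0 : (0 : ℝ) < q := by positivity
  have hn1 : (1 : ℝ) ≤ n := by exact_mod_cast Module.finrank_pos
  have hlogp : 0 ≤ Real.log p := Real.log_natCast_nonneg p
  have hlogq : 0 ≤ Real.log q := Real.log_natCast_nonneg q
  have hsum := mul_le_mul_of_nonneg_left (sum_card_idealsLE_div_pow_le hC0 hC X hq2) hlogq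
  refine hsum.trans ?_
  split_ifs with hqp
  · have hqp' : p = q := hqp.minFac_eq
    rw [hqp', mul_add]
    have : 0 ≤ 2 * C * X * (Real.log q / (q : ℝ) ^ 2) := by positivity
    have : Real.log q * (2 * C * X / (q : ℝ) ^ 2) = 2 * C * X * (Real.log q / (q : ℝ) ^ 2) := by
      ring
    nlinarith
  · have hf2 : 2 ≤ f := by
      by_contra h
      have : f = 1 := by omega
      rw [this, pow_one] at hN
      exact hqp (hN ▸ hp)
    have hq2' : (2 : ℝ) ≤ q := by exact_mod_cast hq2
    have h1 : ((idealsLE K (X / q)).card : ℝ) + 2 * C * X / (q : ℝ) ^ 2 ≤ 2 * C * X / q := by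
      have h2 : ((idealsLE K (X / q)).card : ℝ) ≤ C * X / q := by
        refine (hC _).trans ?_
        rw [mul_div_assoc]
        gcongr
        exact Nat.cast_div_le
      have h3 : 2 * C * X / (q : ℝ) ^ 2 ≤ C * X / q := by
        rw [div_le_div_iff₀ (by positivity) hq0]
        have : 0 ≤ C * X * q := by positivity
        nlinarith
      have h4 : 2 * C * X / q = C * X / q + C * X / q := by ring
      linarith
    have h5 : Real.log q / q ≤ n * (Real.log p / (p : ℝ) ^ 2) := by
      have h6 : Real.log q = f * Real.log p := by rw [hN]; push_cast; rw [Real.log_pow]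
      have h7 : (p : ℝ) ^ 2 ≤ q := by
        rw [hN]; push_cast
        exact pow_le_pow_right₀ (by exact_mod_cast hp.one_lt.le) hf2
      have h8 : (f : ℝ) ≤ n := by exact_mod_cast hfn
      rw [h6, ← mul_div_assoc]
      gcongr
    calc _ ≤ Real.log q * (2 * C * X / q) := by gcongr
      _ = 2 * C * X * (Real.log q / q) := by ring
      _ ≤ 2 * C * X * (n * (Real.log p / (p : ℝ) ^ 2)) := by gcongr
      _ = _ := by ring

theorem sum_log_degreeOnePrimesLE_le (X : ℕ) :
    ∑ P ∈ degreeOnePrimesLE K X, Real.log (absNorm P) ≤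
      Module.finrank ℚ K * (Real.log 4 * X) := by
  have h1 : ∑ P ∈ degreeOnePrimesLE K X, Real.log (absNorm P) =
      ∑ P ∈ degreeOnePrimesLE K X, Real.log ((absNorm P).minFac) :=
    Finset.sum_congr rfl fun P hP => by rw [(Finset.mem_filter.mp hP).2.minFac_eq]
  rw [h1]
  refine (sum_minFac_absNorm_le (X := X) _ (Finset.filter_subset _ _) (fun n => Real.log n)
    fun n => Real.log_natCast_nonneg n).trans ?_
  rw [← Chebyshev.theta_eq_sum_primesLE_log]
  gcongr
  exact Chebyshev.theta_le_log4_mul_x (Nat.cast_nonneg X)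

theorem sum_log_mul_card_degreeOnePrimesLE_le {C D : ℝ} {Y : ℕ} (hC0 : 0 < C) (hD0 : 0 ≤ D)
    (hC : ∀ n : ℕ, ((idealsLE K n).card : ℝ) ≤ C * n)
    (hD : ∀ n : ℕ, Y ≤ n → ((idealsLE K n).card : ℝ) ≤ D * n) (X : ℕ) :
    ∑ P ∈ degreeOnePrimesLE K X, Real.log (absNorm P) * ((idealsLE K (X / absNorm P)).card : ℝ) ≤
      D * X * ∑ P ∈ degreeOnePrimesLE K X, Real.log (absNorm P) / absNorm P +
        C * Y * (Module.finrank ℚ K * (Real.log 4 * X)) := by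
  have h1 : ∀ P ∈ degreeOnePrimesLE K X,
      Real.log (absNorm P) * ((idealsLE K (X / absNorm P)).card : ℝ) ≤
      D * X * (Real.log (absNorm P) / absNorm P) + C * Y * Real.log (absNorm P) := by
    intro P hP
    have hlog : 0 ≤ Real.log (absNorm P) := Real.log_natCast_nonneg _
    have h2 : ((idealsLE K (X / absNorm P)).card : ℝ) ≤ D * (X / absNorm P) + C * Y := by
      rcases le_or_gt Y (X / absNorm P) with h | h
      · have h3 : ((idealsLE K (X / absNorm P)).card : ℝ) ≤ D * (X / absNorm P) := by
          refine (hD _ h).trans ?_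
          gcongr
          exact Nat.cast_div_le
        have : 0 ≤ C * Y := by positivity
        linarith
      · have h3 : ((idealsLE K (X / absNorm P)).card : ℝ) ≤ C * Y := by
          refine (hC _).trans ?_
          gcongr
        have : 0 ≤ D * ((X : ℝ) / absNorm P) := by positivity
        linarith
    calc _ ≤ Real.log (absNorm P) * (D * (X / absNorm P) + C * Y) := by gcongr
      _ = _ := by ring
  refine (Finset.sum_le_sum h1).trans ?_
  rw [Finset.sum_add_distrib, ← Finset.mul_sum, ← Finset.mul_sum]
  gcongr
  exact sum_log_degreeOnePrimesLE_le X

theorem sum_log_absNorm_ge {C c : ℝ} (hC0 : 0 < C)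
    (hC : ∀ n : ℕ, ((idealsLE K n).card : ℝ) ≤ C * n) {X m : ℕ} (hm : 0 < m) (hmX : m ≤ X)
    (hc : c * X ≤ (idealsLE K X).card) :
    (c - C / m) * X * (Real.log X - Real.log m) ≤
      ∑ I ∈ idealsLE K X, Real.log (absNorm I) := by
  have hm' : (0 : ℝ) < m := by exact_mod_cast hm
  have hX' : (0 : ℝ) < X := by exact_mod_cast hm.trans_le hmX
  have hL : 0 ≤ Real.log X - Real.log m :=
    sub_nonneg.mpr (Real.log_le_log hm' (by exact_mod_cast hmX))
  have hsub : idealsLE K (X / m) ⊆ idealsLE K X := fun I hI => by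
    rw [mem_idealsLE] at hI ⊢
    exact ⟨hI.1, hI.2.trans (Nat.div_le_self _ _)⟩
  have hcard : (c - C / m) * X ≤ ((idealsLE K X \ idealsLE K (X / m)).card : ℝ) := by
    rw [Finset.cast_card_sdiff hsub]
    have h1 : ((idealsLE K (X / m)).card : ℝ) ≤ C * (X / m) := by
      refine (hC _).trans ?_
      gcongr
      exact Nat.cast_div_le
    have h2 : (c - C / m) * X = c * X - C * (X / m) := by ring
    linarith
  calc _ ≤ ((idealsLE K X \ idealsLE K (X / m)).card : ℝ) * (Real.log X - Real.log m) := by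
        gcongr
    _ = ∑ I ∈ idealsLE K X \ idealsLE K (X / m), (Real.log X - Real.log m) := by
        rw [Finset.sum_const, nsmul_eq_mul]
    _ ≤ ∑ I ∈ idealsLE K X \ idealsLE K (X / m), Real.log (absNorm I) := by
        refine Finset.sum_le_sum fun I hI => ?_
        rw [Finset.mem_sdiff, mem_idealsLE, mem_idealsLE] at hI
        have h1 : X / m < absNorm I := by
          by_contra h
          exact hI.2 ⟨hI.1.1, by omega⟩
        rw [Nat.div_lt_iff_lt_mul hm] at h1
        rw [← Real.log_div hX'.ne' hm'.ne']
        refine Real.log_le_log (by positivity) ?_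
        rw [div_le_iff₀ hm']
        exact_mod_cast h1.le
    _ ≤ _ := Finset.sum_le_sum_of_subset_of_nonneg Finset.sdiff_subset fun I _ _ =>
        Real.log_natCast_nonneg _

variable (K) in
/-- A lower bound in Mertens' theorem for the prime ideals of degree one of a number field. -/
theorem eventually_sum_log_div_degreeOnePrimesLE_ge {ε : ℝ} (hε : 0 < ε) :
    ∀ᶠ X : ℕ in atTop, (1 - ε) * Real.log X ≤
      ∑ P ∈ degreeOnePrimesLE K X, Real.log (absNorm P) / absNorm P := by
  obtain ⟨E, hE0, hE⟩ := exists_sum_log_div_sq_le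
  obtain ⟨C, hC0, hC⟩ := exists_card_idealsLE_le_mul K
  set c := dedekindZeta_residue K with hc
  have hc0 : 0 < c := dedekindZeta_residue_pos K
  set n := Module.finrank ℚ K with hn
  set η := c * ε / 8 with hη
  have hη0 : 0 < η := by positivity
  have hlim := tendsto_card_idealsLE_div K
  obtain ⟨Y, hY⟩ := eventually_atTop.mp ((hlim.eventually_lt_const
    (show c < c + η by linarith)).and ((hlim.eventually_const_lt
    (show c - η < c by linarith)).and (eventually_gt_atTop 0)))
  have hup : ∀ k : ℕ, Y ≤ k → ((idealsLE K k).card : ℝ) ≤ (c + η) * k := fun k hk => by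
    have h0 : (0 : ℝ) < k := by exact_mod_cast (hY k hk).2.2
    have := (hY k hk).1
    rw [div_lt_iff₀ h0] at this
    exact this.le
  have hlow : ∀ k : ℕ, Y ≤ k → (c - η) * k ≤ ((idealsLE K k).card : ℝ) := fun k hk => by
    have h0 : (0 : ℝ) < k := by exact_mod_cast (hY k hk).2.2
    have := (hY k hk).2.1
    rw [lt_div_iff₀ h0] at this
    exact this.le
  obtain ⟨m, hm⟩ := exists_nat_gt (C / η)
  have hm0 : (0 : ℝ) < m := lt_trans (by positivity) hm
  have hm0' : 0 < m := by exact_mod_cast hm0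
  have hCm : C / m ≤ η := by
    rw [div_lt_iff₀ hη0] at hm
    rw [div_le_iff₀ hm0]
    linarith
  set B := C * Y * (n * Real.log 4) + 2 * C * n * (n * E) with hB
  have hlogbig := (Real.tendsto_log_atTop.comp tendsto_natCast_atTop_atTop).eventually_ge_atTop
    (2 / (c * ε) * (B + c * Real.log m))
  filter_upwards [eventually_ge_atTop Y, eventually_ge_atTop m, eventually_gt_atTop 0, hlogbig]
    with X hXY hXm hX0 hXlog
  have hX : (0 : ℝ) < X := by exact_mod_cast hX0
  set S := ∑ P ∈ degreeOnePrimesLE K X, Real.log (absNorm P) / absNorm P with hS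
  have hlower := sum_log_absNorm_ge hC0 hC hm0' hXm (hlow X hXY)
  have hupper : ∑ I ∈ idealsLE K X, Real.log (absNorm I) ≤ (c + η) * X * S + B * X := by
    refine (sum_log_absNorm_le X).trans ((Finset.sum_le_sum fun P hP =>
      log_mul_sum_card_le hC0 hC X hP).trans ?_)
    rw [Finset.sum_add_distrib, ← Finset.sum_filter, ← Finset.mul_sum]
    have h1 := sum_log_mul_card_degreeOnePrimesLE_le hC0 (by positivity : 0 ≤ c + η) hC hup X
    have h2 : ∑ P ∈ primeIdealsLE K X,
        (Real.log (absNorm P).minFac / ((absNorm P).minFac : ℝ) ^ 2) ≤ n * E := by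
      refine (sum_minFac_absNorm_le (X := X) _ subset_rfl
        (fun k => Real.log k / (k : ℝ) ^ 2) fun k =>
          div_nonneg (Real.log_natCast_nonneg k) (by positivity)).trans ?_
      gcongr
      exact hE _
    have h3 : 2 * C * X * n * ∑ P ∈ primeIdealsLE K X,
        (Real.log (absNorm P).minFac / ((absNorm P).minFac : ℝ) ^ 2) ≤
        2 * C * X * n * (n * E) := by gcongr
    rw [hB]
    refine (add_le_add h1 h3).trans (le_of_eq ?_)
    ring
  have hL : 0 ≤ Real.log X - Real.log m :=
    sub_nonneg.mpr (Real.log_le_log hm0 (by exact_mod_cast hXm))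
  have hlogm : 0 ≤ Real.log m := Real.log_natCast_nonneg m
  have hkey : (c - 2 * η) * (Real.log X - Real.log m) ≤ (c + η) * S + B := by
    have h1 : (c - 2 * η) * X * (Real.log X - Real.log m) ≤
        (c - η - C / m) * X * (Real.log X - Real.log m) := by
      have h0 : c - 2 * η ≤ c - η - C / m := by linarith
      exact mul_le_mul_of_nonneg_right (mul_le_mul_of_nonneg_right h0 hX.le) hL
    have h2 := h1.trans (hlower.trans hupper)
    have h3 : X * ((c - 2 * η) * (Real.log X - Real.log m)) ≤ X * ((c + η) * S + B) := by
      linarith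
    exact le_of_mul_le_mul_left h3 hX
  simp only [Function.comp_apply] at hXlog
  rw [div_mul_eq_mul_div, div_le_iff₀ (by positivity)] at hXlog
  by_contra! hlt
  have h1 : (c + η) * S < (c + η) * ((1 - ε) * Real.log X) := by gcongr
  have hlogX : 0 ≤ Real.log X := Real.log_natCast_nonneg X
  have h2 : (c + η) * ((1 - ε) * Real.log X) ≤ (c - 7 * η) * Real.log X := by
    have : (c + η) * (1 - ε) ≤ c - 7 * η := by
      have : c * ε = 8 * η := by rw [hη]; ring
      nlinarith
    nlinarith
  have h3 : 2 * η * Real.log m ≥ 0 := by positivity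
  have h4 : c * ε = 8 * η := by rw [hη]; ring
  rw [h4] at hXlog
  nlinarith

/-- A multiple of the ring of integers lies in the order generated by an integral generator. -/
theorem exists_intCast_mul_eq_aeval {θ : 𝓞 K} (hθ : Algebra.adjoin ℚ {(θ : K)} = ⊤) :
    ∃ m : ℤ, m ≠ 0 ∧ ∀ x : 𝓞 K, ∃ h : Polynomial ℤ, (m : 𝓞 K) * x = Polynomial.aeval θ h := by
  have hθQ : IsIntegral ℚ (θ : K) := Algebra.IsIntegral.isIntegral _
  have hθZ : IsIntegral ℤ (θ : K) := θ.isIntegral_coe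
  set pb := PowerBasis.ofAdjoinEqTop hθQ hθ with hpb
  have hgen : pb.gen = (θ : K) := PowerBasis.ofAdjoinEqTop_gen hθQ hθ
  have hint : IsIntegral ℤ (Algebra.discr ℚ pb.basis) := by
    refine Algebra.discr_isIntegral ℚ fun i => ?_
    rw [pb.basis_eq_pow, hgen]
    exact hθZ.pow _
  obtain ⟨m, hm⟩ := IsIntegrallyClosed.isIntegral_iff.mp hint
  refine ⟨m, ?_, fun x => ?_⟩
  · rintro rfl
    exact Algebra.discr_not_zero_of_basis ℚ pb.basis (by rw [← hm]; simp)
  · have h1 := Algebra.discr_mul_isIntegral_mem_adjoin ℚ (B := pb) (by rw [hgen]; exact hθZ)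
      x.isIntegral_coe
    rw [hgen, Algebra.adjoin_singleton_eq_range_aeval, ← hm] at h1
    obtain ⟨h, hh⟩ := h1
    refine ⟨h, ?_⟩
    apply RingOfIntegers.coe_injective
    have h2 : ((Polynomial.aeval θ h : 𝓞 K) : K) = Polynomial.aeval (θ : K) h :=
      (Polynomial.aeval_algebraMap_apply K θ h).symm
    refine Eq.trans ?_ (hh.symm.trans h2.symm)
    simp [Algebra.smul_def]

/-- Modulo a prime ideal of prime norm `p` every element is congruent to an integer in `[0, p)`. -/
theorem exists_natCast_sub_mem {P : Ideal (𝓞 K)} (hP : (absNorm P).Prime) (x : 𝓞 K) :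
    ∃ r < absNorm P, x - (r : 𝓞 K) ∈ P := by
  have hcard : Nat.card (𝓞 K ⧸ P) = absNorm P := by
    rw [absNorm_apply]; rfl
  have : Finite (𝓞 K ⧸ P) := Nat.finite_of_card_ne_zero (by rw [hcard]; exact hP.ne_zero)
  have := Fintype.ofFinite (𝓞 K ⧸ P)
  rw [Nat.card_eq_fintype_card] at hcard
  have : NeZero (absNorm P) := ⟨hP.ne_zero⟩
  set e := ZMod.ringEquivOfPrime (𝓞 K ⧸ P) hP hcard
  refine ⟨(e.symm (Ideal.Quotient.mk P x)).val, ZMod.val_lt _, ?_⟩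
  rw [← Ideal.Quotient.eq, map_natCast, ← map_natCast e, ZMod.natCast_zmod_val,
    RingEquiv.apply_symm_apply]

theorem intCast_mem_iff_absNorm_dvd {P : Ideal (𝓞 K)} (hP : (absNorm P).Prime) (n : ℤ) :
    (n : 𝓞 K) ∈ P ↔ (absNorm P : ℤ) ∣ n := by
  constructor
  · intro h
    by_contra hn
    have hco : IsCoprime (absNorm P : ℤ) n :=
      (Prime.coprime_iff_not_dvd (Nat.prime_iff_prime_int.mp hP)).mpr hn
    obtain ⟨a, b, hab⟩ := hco
    have h1 : (1 : 𝓞 K) ∈ P := by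
      have : (1 : 𝓞 K) = (a : 𝓞 K) * (absNorm P : 𝓞 K) + (b : 𝓞 K) * (n : 𝓞 K) := by
        exact_mod_cast hab.symm
      rw [this]
      exact P.add_mem (P.mul_mem_left _ (absNorm_mem P)) (P.mul_mem_left _ h)
    rw [← Ideal.eq_top_iff_one] at h1
    rw [h1, absNorm_top] at hP
    exact Nat.not_prime_one hP
  · rintro ⟨k, rfl⟩
    push_cast
    exact P.mul_mem_right _ (absNorm_mem P)

theorem aeval_sub_intCast_eval_mem {R : Type*} [CommRing R] {P : Ideal R} {θ : R} {s : ℤ}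
    (h : θ - (s : R) ∈ P) (f : Polynomial ℤ) :
    Polynomial.aeval θ f - ((f.eval s : ℤ) : R) ∈ P := by
  have h1 : ((f.eval s : ℤ) : R) = Polynomial.aeval (s : R) f := by
    simpa using (Polynomial.aeval_algebraMap_apply R s f).symm
  rw [h1, Polynomial.aeval_def, Polynomial.aeval_def, Polynomial.eval₂_eq_eval_map,
    Polynomial.eval₂_eq_eval_map]
  exact P.mem_of_dvd (Polynomial.sub_dvd_eval_sub _ _ _) h

/-- A prime ideal of prime norm `p` is determined by the residue modulo it of an integral
generator, as soon as `p` does not divide the index of the order this generates. -/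
theorem eq_of_sub_intCast_mem {θ : 𝓞 K} {m : ℤ}
    (hm : ∀ x : 𝓞 K, ∃ h : Polynomial ℤ, (m : 𝓞 K) * x = Polynomial.aeval θ h)
    {P Q : Ideal (𝓞 K)} (hQ' : Q.IsPrime) (hP : (absNorm P).Prime)
    (hPQ : absNorm P = absNorm Q) (hpm : ¬ (absNorm Q : ℤ) ∣ m)
    {s : ℤ} (hsP : θ - (s : 𝓞 K) ∈ P) (hsQ : θ - (s : 𝓞 K) ∈ Q) : P ≤ Q := by
  intro x hx
  obtain ⟨h, hh⟩ := hm x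
  have h1 : ((h.eval s : ℤ) : 𝓞 K) ∈ P := by
    have h2 := P.sub_mem (P.mul_mem_left (m : 𝓞 K) hx)
      (hh ▸ aeval_sub_intCast_eval_mem hsP h : (m : 𝓞 K) * x - ((h.eval s : ℤ) : 𝓞 K) ∈ P)
    simpa using h2
  rw [intCast_mem_iff_absNorm_dvd hP, hPQ, ← intCast_mem_iff_absNorm_dvd (hPQ ▸ hP)] at h1
  have h3 : (m : 𝓞 K) * x ∈ Q := by
    have h2 := Q.add_mem (aeval_sub_intCast_eval_mem hsQ h) h1
    rw [← hh] at h2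
    simpa using h2
  refine (hQ'.mem_or_mem h3).resolve_left fun h4 => hpm ?_
  rwa [intCast_mem_iff_absNorm_dvd (hPQ ▸ hP)] at h4

/-- A prime ideal of prime norm `p` gives a root modulo `p` of a defining polynomial. -/
theorem exists_root_of_absNorm_prime {g : Polynomial ℤ} (hg : 1 ≤ g.natDegree) {θ : 𝓞 K}
    (hθ : Polynomial.aeval θ g.integralNormalization = 0) {P : Ideal (𝓞 K)}
    (hP : (absNorm P).Prime) (hlead : ¬ (absNorm P : ℤ) ∣ g.leadingCoeff) :
    ∃ r < absNorm P, (absNorm P : ℤ) ∣ g.eval (r : ℤ) ∧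
      θ - ((g.leadingCoeff * r : ℤ) : 𝓞 K) ∈ P := by
  have hpr : Prime (absNorm P : ℤ) := Nat.prime_iff_prime_int.mp hP
  obtain ⟨a, b, hab⟩ := (Prime.coprime_iff_not_dvd hpr).mpr hlead
  obtain ⟨r, hr, hr'⟩ := exists_natCast_sub_mem hP ((b : 𝓞 K) * θ)
  have hmem : θ - ((g.leadingCoeff * r : ℤ) : 𝓞 K) ∈ P := by
    have h1 : (1 : 𝓞 K) = (a : 𝓞 K) * (absNorm P : 𝓞 K) + (b : 𝓞 K) * (g.leadingCoeff : 𝓞 K) := by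
      exact_mod_cast hab.symm
    have h2 : θ - ((g.leadingCoeff * r : ℤ) : 𝓞 K) =
        (a : 𝓞 K) * θ * (absNorm P : 𝓞 K) +
          (g.leadingCoeff : 𝓞 K) * ((b : 𝓞 K) * θ - (r : 𝓞 K)) := by
      push_cast
      linear_combination θ * h1
    rw [h2]
    exact P.add_mem (P.mul_mem_left _ (absNorm_mem P)) (P.mul_mem_left _ hr')
  refine ⟨r, hr, ?_, hmem⟩
  have h3 := aeval_sub_intCast_eval_mem hmem g.integralNormalization
  have h4 := Polynomial.integralNormalization_eval₂_leadingCoeff_mul hg (RingHom.id ℤ) (r : ℤ)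
  simp only [RingHom.id_apply, Polynomial.eval₂_id] at h4
  rw [hθ, zero_sub, neg_mem_iff, intCast_mem_iff_absNorm_dvd hP, h4] at h3
  exact (hpr.dvd_or_dvd h3).resolve_left fun h => hlead (hpr.dvd_of_dvd_pow h)

/-- The number of prime ideals of norm `p` is at most the number of roots modulo `p`. -/
theorem card_filter_absNorm_eq_le_card_rootsMod {g : Polynomial ℤ} (hg : 1 ≤ g.natDegree) {θ : 𝓞 K}
    (hθ : Polynomial.aeval θ g.integralNormalization = 0) {m : ℤ}
    (hm : ∀ x : 𝓞 K, ∃ h : Polynomial ℤ, (m : 𝓞 K) * x = Polynomial.aeval θ h)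
    {Φ : ℤ → ℤ → ℤ} (hΦ : ∀ r, Φ r 1 = g.eval r) {p : ℕ}
    (hlead : ¬ (p : ℤ) ∣ g.leadingCoeff) (hpm : ¬ (p : ℤ) ∣ m) (X : ℕ) :
    ((degreeOnePrimesLE K X).filter fun P => absNorm P = p).card ≤ (rootsMod Φ p).card := by
  have hex : ∀ P ∈ (degreeOnePrimesLE K X).filter (fun P => absNorm P = p),
      ∃ r ∈ rootsMod Φ p, θ - ((g.leadingCoeff * r : ℤ) : 𝓞 K) ∈ P := by
    intro P hP
    rw [Finset.mem_filter, degreeOnePrimesLE, Finset.mem_filter] at hP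
    obtain ⟨⟨-, hp⟩, rfl⟩ := hP
    obtain ⟨r, hr, hr1, hr2⟩ := exists_root_of_absNorm_prime hg hθ hp hlead
    refine ⟨r, ?_, hr2⟩
    rw [rootsMod, Finset.mem_filter, Finset.mem_range, hΦ]
    exact ⟨hr, hr1⟩
  choose! f hf1 hf2 using hex
  refine Finset.card_le_card_of_injOn f hf1 fun P hP Q hQ hPQ => ?_
  have hP2 := hf2 P hP
  have hQ2 := hf2 Q hQ
  have hPQ' : f P = f Q := hPQ
  rw [hPQ'] at hP2
  rw [Finset.mem_coe, Finset.mem_filter, degreeOnePrimesLE, Finset.mem_filter,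
    mem_primeIdealsLE] at hP hQ
  have hN : absNorm P = absNorm Q := hP.2.trans hQ.2.symm
  refine le_antisymm ?_ ?_
  · exact eq_of_sub_intCast_mem hm hQ.1.1.2.2 hP.1.2 hN (by rwa [hQ.2]) hP2 hQ2
  · exact eq_of_sub_intCast_mem hm hP.1.1.2.2 hQ.1.2 hN.symm (by rwa [hP.2]) hQ2 hP2

/-- A lower bound in Mertens' theorem for the number of roots modulo `p` of an integral polynomial
with a root generating a number field. -/
theorem exists_eventually_sum_card_rootsMod_ge_of_adjoin_eq_top {g : Polynomial ℤ} (hg0 : g ≠ 0)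
    (hdeg : 1 ≤ g.natDegree) {α : K} (hαg : Polynomial.aeval α g = 0)
    (hα : Algebra.adjoin ℚ {α} = ⊤) {Φ : ℤ → ℤ → ℤ} (hΦ : ∀ r, Φ r 1 = g.eval r) :
    ∃ B : ℕ, (∀ p, B < p → ¬ (p : ℤ) ∣ g.leadingCoeff) ∧ ∀ ε : ℝ, 0 < ε →
      ∀ᶠ X : ℕ in atTop, (1 - ε) * Real.log X ≤
        ∑ p ∈ (Nat.primesLE X).filter (fun p => B < p),
          (rootsMod Φ p).card * (Real.log p / p) := by
  have hl0 : g.leadingCoeff ≠ 0 := Polynomial.leadingCoeff_ne_zero.mpr hg0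
  have hG : Polynomial.aeval ((g.leadingCoeff : K) * α) g.integralNormalization = 0 := by
    have := Polynomial.integralNormalization_eval₂_leadingCoeff_mul hdeg (algebraMap ℤ K) α
    rw [Polynomial.aeval_def] at hαg ⊢
    rw [hαg, mul_zero] at this
    simpa using this
  have hint : IsIntegral ℤ ((g.leadingCoeff : K) * α) :=
    ⟨_, Polynomial.monic_integralNormalization hg0, hG⟩
  set θ : 𝓞 K := ⟨_, hint⟩ with hθ
  have hθG : Polynomial.aeval θ g.integralNormalization = 0 := by
    apply RingOfIntegers.coe_injective
    rw [map_zero]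
    exact (Polynomial.aeval_algebraMap_apply K θ _).symm.trans hG
  have hadj : Algebra.adjoin ℚ {(θ : K)} = ⊤ := by
    rw [eq_top_iff, ← hα]
    refine Algebra.adjoin_le ?_
    rw [Set.singleton_subset_iff]
    have h1 : α = ((g.leadingCoeff : ℚ)⁻¹) • (θ : K) := by
      have h2 : (θ : K) = (g.leadingCoeff : ℚ) • α := by
        rw [Algebra.smul_def]
        simp only [hθ, map_intCast]
        rfl
      rw [h2, smul_smul, inv_mul_cancel₀ (by exact_mod_cast hl0), one_smul]
    rw [h1]
    exact Subalgebra.smul_mem _ (Algebra.self_mem_adjoin_singleton ℚ _) _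
  obtain ⟨m, hm0, hm⟩ := exists_intCast_mul_eq_aeval hadj
  have hndvd : ∀ k : ℤ, k ≠ 0 → ∀ p : ℕ, k.natAbs < p → ¬ (p : ℤ) ∣ k := fun k hk p hp h => by
    rw [Int.natCast_dvd] at h
    exact absurd (Nat.le_of_dvd (Int.natAbs_pos.mpr hk) h) (by omega)
  set B := max m.natAbs g.leadingCoeff.natAbs with hB
  have hBl : ∀ p, B < p → ¬ (p : ℤ) ∣ g.leadingCoeff := fun p hp =>
    hndvd _ hl0 p ((le_max_right _ _).trans_lt hp)
  refine ⟨B, hBl, fun ε hε => ?_⟩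
  set S₀ := ∑ P ∈ degreeOnePrimesLE K B, Real.log (absNorm P) / absNorm P with hS₀
  have hlogbig := (Real.tendsto_log_atTop.comp tendsto_natCast_atTop_atTop).eventually_ge_atTop
    (S₀ / (ε / 2))
  filter_upwards [eventually_sum_log_div_degreeOnePrimesLE_ge K (half_pos hε), hlogbig]
    with X hX hXlog
  simp only [Function.comp_apply] at hXlog
  rw [div_le_iff₀ (by positivity)] at hXlog
  have hnn : ∀ n : ℕ, 0 ≤ Real.log n / n := fun n =>
    div_nonneg (Real.log_natCast_nonneg n) (by positivity)
  rw [← Finset.sum_filter_add_sum_filter_not _ (fun P => B < absNorm P)] at hX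
  have h1 : ∑ P ∈ (degreeOnePrimesLE K X).filter (fun P => ¬ B < absNorm P),
      Real.log (absNorm P) / absNorm P ≤ S₀ := by
    refine Finset.sum_le_sum_of_subset_of_nonneg (fun P hP => ?_) fun P _ _ => hnn _
    rw [degreeOnePrimesLE, Finset.mem_filter, Finset.mem_filter, mem_primeIdealsLE] at hP
    rw [degreeOnePrimesLE, Finset.mem_filter, mem_primeIdealsLE]
    exact ⟨⟨hP.1.1.1, not_lt.mp hP.2, hP.1.1.2.2⟩, hP.1.2⟩
  have h2 : ∑ P ∈ (degreeOnePrimesLE K X).filter (fun P => B < absNorm P),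
      Real.log (absNorm P) / absNorm P ≤
      ∑ p ∈ (Nat.primesLE X).filter (fun p => B < p),
          (rootsMod Φ p).card * (Real.log p / p) := by
    have hmaps : ∀ P ∈ (degreeOnePrimesLE K X).filter (fun P => B < absNorm P),
        absNorm P ∈ (Nat.primesLE X).filter (fun p => B < p) := fun P hP => by
      rw [degreeOnePrimesLE, Finset.mem_filter, Finset.mem_filter, mem_primeIdealsLE] at hP
      rw [Finset.mem_filter, Nat.mem_primesLE]
      exact ⟨⟨hP.1.1.2.1, hP.1.2⟩, hP.2⟩
    rw [← Finset.sum_fiberwise_of_maps_to hmaps]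
    refine Finset.sum_le_sum fun p hp => ?_
    have hBp := (Finset.mem_filter.mp hp).2
    rw [Finset.sum_congr rfl (g := fun _ => Real.log p / p) fun P hP => by
      rw [(Finset.mem_filter.mp hP).2], Finset.sum_const, nsmul_eq_mul]
    refine mul_le_mul_of_nonneg_right ?_ (hnn p)
    have h3 := card_filter_absNorm_eq_le_card_rootsMod hdeg hθG hm hΦ (hBl p hBp)
      (hndvd m hm0 p ((le_max_left _ _).trans_lt hBp)) X
    refine le_trans ?_ (Nat.cast_le.mpr h3)
    refine Nat.cast_le.mpr (Finset.card_le_card ?_)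
    exact Finset.filter_subset_filter _ (Finset.filter_subset _ _)
  linarith

/-- A lower bound in Mertens' theorem for the number of roots modulo `p` of an irreducible
polynomial. -/
theorem exists_eventually_sum_card_rootsMod_ge {g : Polynomial ℤ}
    (hg : Irreducible (g.map (Int.castRingHom ℚ))) {Φ : ℤ → ℤ → ℤ}
    (hΦ : ∀ r, Φ r 1 = g.eval r) :
    ∃ B : ℕ, (∀ p, B < p → ¬ (p : ℤ) ∣ g.leadingCoeff) ∧ ∀ ε : ℝ, 0 < ε →
      ∀ᶠ X : ℕ in atTop, (1 - ε) * Real.log X ≤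
        ∑ p ∈ (Nat.primesLE X).filter (fun p => B < p),
          (rootsMod Φ p).card * (Real.log p / p) := by
  have : Fact (Irreducible (g.map (Int.castRingHom ℚ))) := ⟨hg⟩
  have hg0 : g ≠ 0 := by
    rintro rfl
    simp at hg
  have hdeg : 1 ≤ g.natDegree := by
    have := hg.natDegree_pos
    rwa [Polynomial.natDegree_map_eq_of_injective (RingHom.injective_int _)] at this
  refine exists_eventually_sum_card_rootsMod_ge_of_adjoin_eq_top
    (α := AdjoinRoot.root (g.map (Int.castRingHom ℚ))) hg0 hdeg ?_ ?_ hΦ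
  · have h := AdjoinRoot.eval₂_root (g.map (Int.castRingHom ℚ))
    rw [Polynomial.eval₂_map] at h
    rw [Polynomial.aeval_def, ← h]
    exact congrArg (fun f => Polynomial.eval₂ f _ g) (Subsingleton.elim _ _)
  · rw [Algebra.adjoin_singleton_eq_range_aeval, AlgHom.range_eq_top]
    intro x
    obtain ⟨q, rfl⟩ := AdjoinRoot.mk_surjective x
    refine ⟨q, ?_⟩
    rw [← AdjoinRoot.aeval_eq, Polynomial.aeval_def, Polynomial.aeval_def]
    exact congrArg (fun f => Polynomial.eval₂ f _ q) (Subsingleton.elim _ _)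

end NumberFieldMertens

section BinaryForms

open Polynomial

theorem MvPolynomial.IsHomogeneous.not_isUnit {σ R : Type*} [CommRing R] [Nontrivial R]
    {p : MvPolynomial σ R} {n : ℕ} (hp : p.IsHomogeneous n) (hn : n ≠ 0) : ¬ IsUnit p := by
  intro h
  have h1 := h.map (MvPolynomial.constantCoeff (σ := σ) (R := R))
  have h2 : p.coeff 0 = 0 := hp.coeff_eq_zero (by simpa using hn.symm)
  rw [MvPolynomial.constantCoeff_eq, h2] at h1
  exact not_isUnit_zero h1

theorem natDegree_aeval_X_one_le {R : Type*} [CommRing R] {F : MvPolynomial (Fin 2) R} {t : ℕ}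
    (hF : F.IsHomogeneous t) : (MvPolynomial.aeval ![(X : R[X]), 1] F).natDegree ≤ t := by
  rw [F.as_sum, map_sum]
  refine natDegree_sum_le_of_forall_le _ _ fun m hm => ?_
  have hm' : m.weight 1 = t := hF (by simpa using hm)
  rw [MvPolynomial.aeval_monomial, Finsupp.prod_fintype _ _ (by simp), Fin.prod_univ_two]
  simp only [Matrix.cons_val_zero, Matrix.cons_val_one, one_pow, mul_one]
  refine (natDegree_C_mul_X_pow_le _ _).trans ?_
  rw [← hm', Finsupp.weight_apply, Finsupp.sum_fintype _ _ (by simp), Fin.sum_univ_two]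
  simp

theorem natDegree_eq_of_irreducible_homogenize {k : Type*} [Field k] {q : k[X]} {t : ℕ}
    (ht : 2 ≤ t) (hq : q.natDegree ≤ t) (hirr : Irreducible (q.homogenize t)) :
    q.natDegree = t := by
  by_contra hne
  obtain ⟨s, rfl⟩ : ∃ s, t = s + 1 := ⟨t - 1, by omega⟩
  have h1 : q.homogenize (s + 1) = q.homogenize s * (1 : k[X]).homogenize 1 := by
    rw [← homogenize_mul q 1 (by omega) (by simp), mul_one]
  rcases hirr.isUnit_or_isUnit h1 with h | h
  · exact (isHomogeneous_homogenize q).not_isUnit (by omega) h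
  · exact (isHomogeneous_homogenize (1 : k[X])).not_isUnit one_ne_zero h

theorem irreducible_of_irreducible_homogenize {k : Type*} [Field k] {q : k[X]} {t : ℕ}
    (ht : 2 ≤ t) (hq : q.natDegree ≤ t) (hirr : Irreducible (q.homogenize t)) :
    Irreducible q := by
  have hdeg := natDegree_eq_of_irreducible_homogenize ht hq hirr
  have hq0 : q ≠ 0 := by
    rintro rfl
    simp at hdeg
    omega
  refine ⟨fun h => ?_, fun a b hab => ?_⟩
  · have := natDegree_eq_zero_of_isUnit h
    omega
  · subst hab
    have ha0 := left_ne_zero_of_mul hq0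
    have hb0 := right_ne_zero_of_mul hq0
    have hunit : ∀ f : k[X], f ≠ 0 → IsUnit (f.homogenize f.natDegree) → IsUnit f := by
      intro f hf h
      rw [isUnit_iff_degree_eq_zero, degree_eq_natDegree hf]
      by_contra h0
      exact (isHomogeneous_homogenize f).not_isUnit (by simpa using h0) h
    rw [← hdeg, natDegree_mul ha0 hb0, homogenize_mul _ _ le_rfl le_rfl] at hirr
    exact (hirr.isUnit_or_isUnit rfl).imp (hunit a ha0) (hunit b hb0)

/-- An irreducible binary form of degree at least two is the homogenization of an irreducible
polynomial of the same degree. -/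
theorem exists_homogenize_eq {F : MvPolynomial (Fin 2) ℤ} {t : ℕ} (ht : 2 ≤ t)
    (hF : F.IsHomogeneous t) (hirr : Irreducible (MvPolynomial.map (Int.castRingHom ℚ) F)) :
    ∃ g : ℤ[X], g.natDegree = t ∧ Irreducible (g.map (Int.castRingHom ℚ)) ∧
      g.homogenize t = F := by
  refine ⟨MvPolynomial.aeval ![X, 1] F, ?_, ?_, homogenize_eq_of_isHomogeneous hF rfl⟩
  all_goals
    have h1 := homogenize_eq_of_isHomogeneous hF rfl
    rw [← h1, ← homogenize_map] at hirr
    have h2 := natDegree_aeval_X_one_le hF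
    rw [← natDegree_map_eq_of_injective (RingHom.injective_int (Int.castRingHom ℚ))] at h2
  · have := natDegree_eq_of_irreducible_homogenize ht h2 hirr
    rwa [natDegree_map_eq_of_injective (RingHom.injective_int _)] at this
  · exact irreducible_of_irreducible_homogenize ht h2 hirr

theorem eval_homogenize_eq_sum {R : Type*} [CommRing R] (g : R[X]) (t : ℕ) (a b : R) :
    MvPolynomial.eval ![a, b] (g.homogenize t) =
      ∑ i ∈ Finset.range (t + 1), g.coeff i * (a ^ i * b ^ (t - i)) := by
  rw [homogenize, map_sum, Finset.Nat.sum_antidiagonal_eq_sum_range_succ_mk]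
  refine Finset.sum_congr rfl fun i _ => ?_
  rw [MvPolynomial.eval_monomial, Finsupp.prod_fintype _ _ (by simp), Fin.prod_univ_two]
  simp

theorem eval_homogenize_one {R : Type*} [CommRing R] {g : R[X]} {t : ℕ} (hg : g.natDegree = t)
    (r : R) : MvPolynomial.eval ![r, 1] (g.homogenize t) = g.eval r := by
  rw [eval_homogenize_eq_sum, eval_eq_sum_range, hg]
  simp

theorem eval_homogenize_eq_zero {g : ℤ[X]} {t : ℕ} (ht : 2 ≤ t) (hg : g.natDegree = t)
    (hirr : Irreducible (g.map (Int.castRingHom ℚ))) {a b : ℤ}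
    (h : MvPolynomial.eval ![a, b] (g.homogenize t) = 0) : a = 0 ∧ b = 0 := by
  have hdeg : (g.map (Int.castRingHom ℚ)).natDegree = t := by
    rw [natDegree_map_eq_of_injective (RingHom.injective_int _), hg]
  have hb : b = 0 := by
    by_contra hb
    have h1 : MvPolynomial.eval ![(a : ℚ), (b : ℚ)]
        ((g.map (Int.castRingHom ℚ)).homogenize t) = 0 := by
      rw [eval_homogenize_eq_sum] at h ⊢
      simp only [coeff_map, eq_intCast]
      exact_mod_cast h
    have hb' : (b : ℚ) ≠ 0 := by exact_mod_cast hb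
    rw [eval_homogenize hdeg.le _ (by simpa using hb')] at h1
    have h2 := (mul_eq_zero.mp h1).resolve_right (pow_ne_zero _ (by simpa using hb'))
    have h3 := degree_eq_one_of_irreducible_of_root hirr h2
    have h4 : (g.map (Int.castRingHom ℚ)).natDegree = 1 := natDegree_eq_of_degree_eq_some h3
    omega
  subst hb
  rw [eval_homogenize_eq_sum, Finset.sum_eq_single t] at h
  · refine ⟨?_, rfl⟩
    have hl : g.coeff t ≠ 0 := by
      rw [← hg, coeff_natDegree, leadingCoeff_ne_zero]
      rintro rfl
      simp at hg
      omega
    simp only [Nat.sub_self, pow_zero, mul_one] at h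
    exact eq_zero_of_pow_eq_zero ((mul_eq_zero.mp h).resolve_left hl)
  · intro i hi hit
    rw [Finset.mem_range] at hi
    rw [zero_pow (by omega), mul_zero, mul_zero]
  · simp

theorem dvd_eval_homogenize (g : ℤ[X]) (t : ℕ) {p a b r : ℤ} (h : p ∣ a - r * b)
    (hr : p ∣ MvPolynomial.eval ![r, 1] (g.homogenize t)) :
    p ∣ MvPolynomial.eval ![a, b] (g.homogenize t) := by
  have h1 : p ∣ MvPolynomial.eval ![a, b] (g.homogenize t) -
      b ^ t * MvPolynomial.eval ![r, 1] (g.homogenize t) := by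
    rw [eval_homogenize_eq_sum, eval_homogenize_eq_sum, Finset.mul_sum, ← Finset.sum_sub_distrib]
    refine Finset.dvd_sum fun i hi => ?_
    rw [Finset.mem_range] at hi
    have h2 : b ^ t = b ^ i * b ^ (t - i) := by rw [← pow_add]; congr 1; omega
    rw [h2, show g.coeff i * (a ^ i * b ^ (t - i)) -
      b ^ i * b ^ (t - i) * (g.coeff i * (r ^ i * 1 ^ (t - i))) =
      (a ^ i - (r * b) ^ i) * (g.coeff i * b ^ (t - i)) by rw [mul_pow, one_pow]; ring]
    exact dvd_mul_of_dvd_left (h.trans (sub_dvd_pow_sub_pow _ _ _)) _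
  have h3 := dvd_add h1 (dvd_mul_of_dvd_right hr (b ^ t))
  rwa [sub_add_cancel] at h3

theorem exists_natAbs_eval_homogenize_le (g : ℤ[X]) (t : ℕ) :
    ∃ C : ℕ, 1 ≤ C ∧ ∀ (a b : ℤ) (n : ℕ), a.natAbs ≤ n → b.natAbs ≤ n →
      (MvPolynomial.eval ![a, b] (g.homogenize t)).natAbs ≤ C * n ^ t := by
  refine ⟨1 + ∑ i ∈ Finset.range (t + 1), (g.coeff i).natAbs, by omega, fun a b n ha hb => ?_⟩
  rw [eval_homogenize_eq_sum]
  calc _ ≤ ∑ i ∈ Finset.range (t + 1), (g.coeff i * (a ^ i * b ^ (t - i))).natAbs :=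
        Int.natAbs_sum_le _ _
    _ ≤ ∑ i ∈ Finset.range (t + 1), (g.coeff i).natAbs * n ^ t := by
        refine Finset.sum_le_sum fun i hi => ?_
        rw [Finset.mem_range] at hi
        rw [Int.natAbs_mul, Int.natAbs_mul, Int.natAbs_pow, Int.natAbs_pow]
        refine Nat.mul_le_mul_left _ ?_
        calc _ ≤ n ^ i * n ^ (t - i) := by gcongr
          _ = n ^ t := by rw [← pow_add]; congr 1; omega
    _ ≤ _ := by
        rw [← Finset.sum_mul]
        exact Nat.mul_le_mul_right _ (by omega)

theorem card_rootsMod_le {g : ℤ[X]} {Φ : ℤ → ℤ → ℤ} (hΦ : ∀ r, Φ r 1 = g.eval r) {p : ℕ}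
    (hp : p.Prime) (hlead : ¬ (p : ℤ) ∣ g.leadingCoeff) :
    (rootsMod Φ p).card ≤ g.natDegree := by
  have : Fact p.Prime := ⟨hp⟩
  set f := g.map (Int.castRingHom (ZMod p)) with hf
  have hf0 : f ≠ 0 := by
    intro h
    have h1 : f.coeff g.natDegree = 0 := by rw [h, coeff_zero]
    rw [hf, coeff_map, eq_intCast, coeff_natDegree, ZMod.intCast_zmod_eq_zero_iff_dvd] at h1
    exact hlead h1
  calc (rootsMod Φ p).card ≤ f.roots.toFinset.card := by
        refine Finset.card_le_card_of_injOn (fun r : ℕ => (r : ZMod p)) ?_ ?_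
        · intro r hr
          rw [Finset.mem_coe, rootsMod, Finset.mem_filter, hΦ] at hr
          rw [Finset.mem_coe, Multiset.mem_toFinset, mem_roots hf0, IsRoot, hf]
          have h1 := (ZMod.intCast_zmod_eq_zero_iff_dvd _ p).mpr hr.2
          rw [← h1, ← eq_intCast (Int.castRingHom (ZMod p)) (eval _ g), ← eval_map_apply]
          simp
        · intro r hr r' hr' h
          rw [Finset.mem_coe, rootsMod, Finset.mem_filter, Finset.mem_range] at hr hr'
          have h1 := (ZMod.natCast_eq_natCast_iff' _ _ _).mp h
          rwa [Nat.mod_eq_of_lt hr.1, Nat.mod_eq_of_lt hr'.1] at h1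
    _ ≤ Multiset.card f.roots := Multiset.toFinset_card_le _
    _ ≤ f.natDegree := card_roots' _
    _ ≤ g.natDegree := natDegree_map_le

end BinaryForms

section FriableValues

open Filter

/-- The values of a form on a box have, on average, a divisor of size almost `N ^ 2` composed of
primes at most `N ^ 2`. -/
theorem eventually_exists_sum_log_mul_card_boxMultiples_ge {g : Polynomial ℤ} {t : ℕ} (ht : 2 ≤ t)
    (hg : g.natDegree = t) (hirr : Irreducible (g.map (Int.castRingHom ℚ))) {ε : ℝ}
    (hε : 0 < ε) (hε1 : ε ≤ 1) :
    ∀ᶠ N : ℕ in atTop, ∃ T : Finset ℕ, (∀ p ∈ T, p.Prime ∧ p ≤ N ^ 2) ∧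
      (2 - ε) * Real.log N * (N : ℝ) ^ 2 ≤ ∑ p ∈ T, Real.log p *
        (boxMultiples (fun a b => MvPolynomial.eval ![a, b] (g.homogenize t)) N p).card := by
  set Φ : ℤ → ℤ → ℤ := fun a b => MvPolynomial.eval ![a, b] (g.homogenize t) with hΦ
  have hΦ1 : ∀ r, Φ r 1 = g.eval r := eval_homogenize_one hg
  obtain ⟨C, hC1, hC⟩ := exists_natAbs_eval_homogenize_le g t
  obtain ⟨E, hE0, hE⟩ := exists_sum_log_div_sq_le
  obtain ⟨B, hBl, hB⟩ := exists_eventually_sum_card_rootsMod_ge hirr hΦ1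
  obtain ⟨k, hk⟩ := exists_nat_gt (384 * (t + 1) / ε)
  have hk0 : (0 : ℝ) < k := lt_trans (by positivity) hk
  have hk0' : 0 < k := by exact_mod_cast hk0
  rw [div_lt_iff₀ hε] at hk
  have htend : Tendsto (fun N : ℕ => (N / k) ^ 2) atTop atTop :=
    (tendsto_pow_atTop two_ne_zero).comp (Nat.tendsto_div_const_atTop hk0'.ne')
  have hlogbig := (Real.tendsto_log_atTop.comp tendsto_natCast_atTop_atTop).eventually_ge_atTop
    ((2 * Real.log (2 * k) + t * E) / (ε / 4))
  filter_upwards [htend.eventually (hB (ε / 8) (by positivity)), hlogbig, eventually_ge_atTop k,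
    eventually_ge_atTop C] with N hN hNlog hNk hNC
  simp only [Function.comp_apply] at hNlog
  rw [div_le_iff₀ (by positivity)] at hNlog
  set s := N / k with hs
  set T := (Nat.primesLE (s ^ 2)).filter (fun p => B < p) with hT
  have hs1 : 1 ≤ s := by rw [hs, Nat.one_le_div_iff hk0']; exact hNk
  have hsN : s ≤ N := Nat.div_le_self _ _
  have hT' : ∀ p ∈ T, p.Prime ∧ p ≤ s ^ 2 := fun p hp => by
    rw [hT, Finset.mem_filter, Nat.mem_primesLE] at hp
    exact ⟨hp.1.2, hp.1.1⟩
  refine ⟨T, fun p hp => ⟨(hT' p hp).1, (hT' p hp).2.trans (Nat.pow_le_pow_left hsN 2)⟩, ?_⟩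
  have hN0 : (0 : ℝ) < N := by exact_mod_cast hk0'.trans_le hNk
  have hs0 : (0 : ℝ) < s := by exact_mod_cast hs1
  have hL : 0 ≤ Real.log N := Real.log_natCast_nonneg N
  have hW : ∀ c d : ℤ, c.natAbs ≤ s → d.natAbs ≤ s →
      Real.log (Φ c d).natAbs ≤ (t + 1) * Real.log N := by
    intro c d hc hd
    rcases Nat.eq_zero_or_pos (Φ c d).natAbs with h0 | h0
    · rw [h0, Nat.cast_zero, Real.log_zero]
      positivity
    · have h1 : (Φ c d).natAbs ≤ N ^ (t + 1) := by
        refine (hC c d N (hc.trans hsN) (hd.trans hsN)).trans ?_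
        rw [pow_succ']
        exact Nat.mul_le_mul_right _ hNC
      calc Real.log (Φ c d).natAbs ≤ Real.log ((N ^ (t + 1) : ℕ) : ℝ) :=
            Real.log_le_log (by exact_mod_cast h0) (by exact_mod_cast h1)
        _ = _ := by push_cast; rw [Real.log_pow]; push_cast; ring
  have hmain := sum_log_mul_card_boxMultiples_ge (Φ := Φ)
    (fun a b => eval_homogenize_eq_zero ht hg hirr)
    (fun p a b r => dvd_eval_homogenize g t) (by positivity) hW T hT'
    (t := t) (fun p hp => hg ▸ card_rootsMod_le hΦ1 (hT' p hp).1
      (hBl p (Finset.mem_filter.mp hp).2)) N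
  have hlogs : 2 * Real.log N - 2 * Real.log (2 * k) ≤ Real.log ((s ^ 2 : ℕ) : ℝ) := by
    have h1 : N ≤ 2 * k * s := by
      have h2 := Nat.lt_mul_div_succ N hk0'
      rw [← hs] at h2
      nlinarith
    have h3 : Real.log N ≤ Real.log (2 * k) + Real.log s := by
      rw [← Real.log_mul (by positivity) hs0.ne']
      exact Real.log_le_log hN0 (by exact_mod_cast h1)
    push_cast
    rw [Real.log_pow]
    push_cast
    linarith
  have hlog2k : 0 ≤ Real.log (2 * k) := by
    have := Real.log_natCast_nonneg (2 * k)
    push_cast at this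
    exact this
  have hsum : (2 - ε / 4) * Real.log N - 2 * Real.log (2 * k) ≤
      ∑ p ∈ T, (rootsMod Φ p).card * (Real.log p / p) := by
    have h1 : (1 - ε / 8) * (2 * Real.log N - 2 * Real.log (2 * k)) ≤
        (1 - ε / 8) * Real.log ((s ^ 2 : ℕ) : ℝ) :=
      mul_le_mul_of_nonneg_left hlogs (by linarith)
    have h2 := h1.trans hN
    have h3 : 0 ≤ ε * Real.log (2 * k) := by positivity
    linarith
  have herr : 96 * N * s * ((t + 1) * Real.log N) ≤ ε / 4 * Real.log N * (N : ℝ) ^ 2 := by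
    have h1 : (s : ℝ) * k ≤ N := by exact_mod_cast Nat.div_mul_le_self N k
    have h2 : 96 * (t + 1) * (s : ℝ) ≤ ε / 4 * N := by
      have : 384 * (t + 1) * (s : ℝ) ≤ k * ε * s := by gcongr
      have : k * ε * (s : ℝ) ≤ ε * N := by
        calc k * ε * (s : ℝ) = ε * (s * k) := by ring
          _ ≤ _ := by gcongr
      linarith
    calc _ = (96 * (t + 1) * (s : ℝ)) * (N * Real.log N) := by ring
      _ ≤ (ε / 4 * N) * (N * Real.log N) := by gcongr
      _ = _ := by ring
  have hE' : (t : ℝ) * N ^ 2 * ∑ p ∈ T, Real.log p / (p : ℝ) ^ 2 ≤ t * E * (N : ℝ) ^ 2 := by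
    calc _ ≤ (t : ℝ) * N ^ 2 * E := by gcongr; exact hE T
      _ = _ := by ring
  have hsum' := mul_le_mul_of_nonneg_left hsum (sq_nonneg (N : ℝ))
  have hNlog' := mul_le_mul_of_nonneg_right hNlog (sq_nonneg (N : ℝ))
  have hpos : 0 ≤ ε * Real.log N * (N : ℝ) ^ 2 := by positivity
  linarith

/-- If the primes at most `y` account for much of the values of `Φ` on a box, few of these values
have a prime factor exceeding `y`. -/
theorem sum_log_mul_card_boxMultiples_add_le {Φ : ℤ → ℤ → ℤ} {N : ℕ} {T : Finset ℕ} {y V : ℝ}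
    (hy : 1 ≤ y) (hT : ∀ p ∈ T, p.Prime ∧ (p : ℝ) ≤ y)
    (h0 : ∀ a ∈ Finset.Icc 1 N, ∀ b ∈ Finset.Icc 1 N, Φ a b ≠ 0)
    (hV : ∀ a ∈ Finset.Icc 1 N, ∀ b ∈ Finset.Icc 1 N, Real.log (Φ a b).natAbs ≤ V) :
    ∑ p ∈ T, Real.log p * (boxMultiples Φ N p).card +
      ((Finset.Icc 1 N ×ˢ Finset.Icc 1 N).filter fun ab =>
        ∃ q : ℕ, q.Prime ∧ q ∣ (Φ ab.1 ab.2).natAbs ∧ y < q).card * Real.log y ≤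
      (N : ℝ) ^ 2 * V := by
  set D := Finset.Icc 1 N ×ˢ Finset.Icc 1 N with hD
  have h1 : ∑ p ∈ T, Real.log p * (boxMultiples Φ N p).card =
      ∑ ab ∈ D, ∑ p ∈ T.filter (fun p : ℕ => (p : ℤ) ∣ Φ ab.1 ab.2), Real.log p := by
    simp_rw [Finset.sum_filter]
    rw [Finset.sum_comm]
    refine Finset.sum_congr rfl fun p _ => ?_
    rw [← Finset.sum_filter, Finset.sum_const, nsmul_eq_mul, mul_comm]
    rfl
  have h2 : ((D.filter fun ab => ∃ q : ℕ, q.Prime ∧ q ∣ (Φ ab.1 ab.2).natAbs ∧ y < q).card : ℝ) *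
      Real.log y = ∑ ab ∈ D, if ∃ q : ℕ, q.Prime ∧ q ∣ (Φ ab.1 ab.2).natAbs ∧ y < q then
        Real.log y else 0 := by
    rw [← Finset.sum_filter, Finset.sum_const, nsmul_eq_mul]
  have hcard : (N : ℝ) ^ 2 * V = ∑ ab ∈ D, V := by
    rw [Finset.sum_const, nsmul_eq_mul, hD, Finset.card_product, Nat.card_Icc]
    push_cast
    simp [sq]
  rw [h1, h2, hcard, ← Finset.sum_add_distrib]
  refine Finset.sum_le_sum fun ab hab => ?_
  rw [hD, Finset.mem_product] at hab
  refine le_trans ?_ (hV ab.1 hab.1 ab.2 hab.2)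
  have hn0 : (Φ ab.1 ab.2).natAbs ≠ 0 := Int.natAbs_ne_zero.mpr (h0 ab.1 hab.1 ab.2 hab.2)
  refine le_trans ?_ (sum_log_primeFactors_le hn0)
  have hsub : T.filter (fun p : ℕ => (p : ℤ) ∣ Φ ab.1 ab.2) ⊆
      (Φ ab.1 ab.2).natAbs.primeFactors := by
    intro p hp
    rw [Finset.mem_filter, Int.natCast_dvd] at hp
    exact Nat.mem_primeFactors.mpr ⟨(hT p hp.1).1, hp.2, hn0⟩
  split_ifs with hbad
  · obtain ⟨q, hq, hqd, hyq⟩ := hbad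
    have hqT : q ∉ T.filter (fun p : ℕ => (p : ℤ) ∣ Φ ab.1 ab.2) := fun h =>
      absurd (hT q (Finset.mem_filter.mp h).1).2 (not_le.mpr hyq)
    calc _ ≤ ∑ p ∈ T.filter (fun p : ℕ => (p : ℤ) ∣ Φ ab.1 ab.2), Real.log p + Real.log q :=
          add_le_add_right (Real.log_le_log (by linarith) hyq.le) _
      _ = ∑ p ∈ insert q (T.filter (fun p : ℕ => (p : ℤ) ∣ Φ ab.1 ab.2)), Real.log p := by
          rw [Finset.sum_insert hqT, add_comm]
      _ ≤ _ := by
          refine Finset.sum_le_sum_of_subset_of_nonneg ?_ fun p _ _ => Real.log_natCast_nonneg p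
          exact Finset.insert_subset (Nat.mem_primeFactors.mpr ⟨hq, hqd, hn0⟩) hsub
  · rw [add_zero]
    exact Finset.sum_le_sum_of_subset_of_nonneg hsub fun p _ _ => Real.log_natCast_nonneg p

theorem exists_prime_dvd_of_lt_Pplus {n : ℕ} {y : ℝ} (hy : 1 ≤ y) (h : y < (Pplus n : ℝ)) :
    ∃ q : ℕ, q.Prime ∧ q ∣ n ∧ y < q := by
  rw [Pplus, Nat.cast_max, lt_max_iff, Nat.cast_one] at h
  have h1 := h.resolve_left (not_lt.mpr hy)
  have hne : n.primeFactors.Nonempty := by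
    by_contra hne
    rw [Finset.not_nonempty_iff_eq_empty] at hne
    rw [hne, Finset.sup_empty] at h1
    norm_num at h1
    linarith
  obtain ⟨q, hq, hq'⟩ := Finset.exists_mem_eq_sup _ hne id
  rw [hq'] at h1
  exact ⟨q, Nat.prime_of_mem_primeFactors hq, Nat.dvd_of_mem_primeFactors hq, h1⟩

end FriableValues

/-- Friable values of an irreducible binary form of degree `t ≥ 4` (Théorème 1.7). -/
theorem friable_values_irreducible_binary_form
    (F : MvPolynomial (Fin 2) ℤ) (t : ℕ) (ht : 4 ≤ t)
    (hhom : F.IsHomogeneous t)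
    (hirr : Irreducible (MvPolynomial.map (Int.castRingHom ℚ) F))
    (ε : ℝ) (hε : 0 < ε) :
    ∃ x₀ : ℝ, ∀ x : ℝ, x₀ ≤ x → ∀ y : ℝ, x ^ (t - 2 : ℕ) ≤ y → y ≤ x ^ (t : ℕ) →
      ∀ u : ℝ, u = Real.log x / Real.log y →
      (1 - (t - 2 : ℝ) * u - ε) * x ^ 2 ≤
        ((((Finset.Icc 1 ⌊x⌋₊) ×ˢ (Finset.Icc 1 ⌊x⌋₊)).filter
            (fun ab => MvPolynomial.eval ![(ab.1 : ℤ), (ab.2 : ℤ)] F ≠ 0 ∧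
              (Pplus (MvPolynomial.eval ![(ab.1 : ℤ), (ab.2 : ℤ)] F).natAbs : ℝ) ≤ y)).card : ℝ) := by
  obtain ⟨g, hg, hgirr, rfl⟩ := exists_homogenize_eq (by omega) hhom hirr
  obtain ⟨C, hC1, hC⟩ := exists_natAbs_eval_homogenize_le g t
  set δ : ℝ := min ε 1 / 2 with hδ
  have hδ0 : 0 < δ := by positivity
  have hδ1 : δ ≤ 1 := by linarith [min_le_right ε 1]
  have hδε : 2 * δ ≤ ε := by linarith [min_le_left ε 1]
  have hlogbig := (Real.tendsto_log_atTop.comp tendsto_natCast_atTop_atTop).eventually_ge_atTop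
    (Real.log C / δ)
  obtain ⟨N₀, hN₀⟩ := Filter.eventually_atTop.mp
    ((eventually_exists_sum_log_mul_card_boxMultiples_ge (by omega) hg hgirr hδ0 hδ1).and hlogbig)
  refine ⟨max N₀ (max 2 (2 / δ)), fun x hx y hxy _ u hu => ?_⟩
  rw [max_le_iff, max_le_iff, div_le_iff₀ hδ0] at hx
  obtain ⟨hxN, hx2, hxδ⟩ := hx
  set N := ⌊x⌋₊ with hN
  have hNx : (N : ℝ) ≤ x := Nat.floor_le (by linarith)
  have hxN1 : x < N + 1 := Nat.lt_floor_add_one x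
  have hN1 : 1 ≤ N := Nat.le_floor (by push_cast; linarith)
  have hN0 : (0 : ℝ) < N := by exact_mod_cast hN1
  obtain ⟨⟨T, hT, hTsum⟩, hClog⟩ := hN₀ N (Nat.le_floor hxN)
  simp only [Function.comp_apply] at hClog
  rw [div_le_iff₀ hδ0] at hClog
  have hx2y : x ^ 2 ≤ y := (pow_le_pow_right₀ (by linarith) (by omega)).trans hxy
  have hy1 : 1 ≤ y := by nlinarith
  have hlogx : 0 < Real.log x := Real.log_pos (by linarith)
  have hlogy : 2 * Real.log x ≤ Real.log y := by
    have := Real.log_le_log (by positivity) hx2y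
    rwa [Real.log_pow] at this
  have hlogy0 : 0 < Real.log y := by linarith
  have hu0 : 0 ≤ u := by rw [hu]; positivity
  have hu2 : u ≤ 1 / 2 := by
    rw [hu, div_le_iff₀ hlogy0]
    linarith
  set Φ : ℤ → ℤ → ℤ := fun a b => MvPolynomial.eval ![a, b] (g.homogenize t) with hΦ
  set D := Finset.Icc 1 N ×ˢ Finset.Icc 1 N with hD
  have hΦ0 : ∀ a ∈ Finset.Icc 1 N, ∀ b ∈ Finset.Icc 1 N, Φ a b ≠ 0 := by
    intro a ha b _ h
    rw [Finset.mem_Icc] at ha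
    have := (eval_homogenize_eq_zero (by omega) hg hgirr h).1
    omega
  have hV : ∀ a ∈ Finset.Icc 1 N, ∀ b ∈ Finset.Icc 1 N,
      Real.log (Φ a b).natAbs ≤ Real.log C + t * Real.log N := by
    intro a ha b hb
    have h1 : (Φ a b).natAbs ≤ C * N ^ t := by
      rw [Finset.mem_Icc] at ha hb
      exact hC a b N (by simpa using ha.2) (by simpa using hb.2)
    have h2 : 0 < (Φ a b).natAbs := Int.natAbs_pos.mpr (hΦ0 a ha b hb)
    rw [← Real.log_pow, ← Real.log_mul (by positivity) (by positivity)]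
    exact Real.log_le_log (by exact_mod_cast h2) (by exact_mod_cast h1)
  have hTy : ∀ p ∈ T, p.Prime ∧ (p : ℝ) ≤ y := fun p hp => by
    refine ⟨(hT p hp).1, le_trans ?_ hx2y⟩
    calc (p : ℝ) ≤ (N : ℝ) ^ 2 := by exact_mod_cast (hT p hp).2
      _ ≤ x ^ 2 := by gcongr
  have hkey := sum_log_mul_card_boxMultiples_add_le hy1 hTy hΦ0 hV
  set bad := D.filter fun ab => ∃ q : ℕ, q.Prime ∧ q ∣ (Φ ab.1 ab.2).natAbs ∧ y < q with hbad
  set good := D.filter fun ab => MvPolynomial.eval ![(ab.1 : ℤ), (ab.2 : ℤ)] (g.homogenize t) ≠ 0 ∧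
    (Pplus (MvPolynomial.eval ![(ab.1 : ℤ), (ab.2 : ℤ)] (g.homogenize t)).natAbs : ℝ) ≤ y with hgood
  have hbadle : (bad.card : ℝ) ≤ ((t - 2 : ℝ) * u + δ) * x ^ 2 := by
    have ht' : (4 : ℝ) ≤ t := by exact_mod_cast ht
    have h1 : (bad.card : ℝ) * Real.log y ≤ (t - 2 + 2 * δ) * Real.log N * (N : ℝ) ^ 2 := by
      have := mul_le_mul_of_nonneg_right hClog (sq_nonneg (N : ℝ))
      linarith
    have h2 : (t - 2 + 2 * δ) * Real.log N * (N : ℝ) ^ 2 ≤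
        (t - 2 + 2 * δ) * Real.log x * x ^ 2 := by
      have h3 : (0 : ℝ) ≤ t - 2 + 2 * δ := by linarith
      have h4 : Real.log N ≤ Real.log x := Real.log_le_log hN0 hNx
      gcongr
    have h5 : (bad.card : ℝ) ≤ (t - 2 + 2 * δ) * u * x ^ 2 := by
      refine le_of_mul_le_mul_right ?_ hlogy0
      have h6 : u * Real.log y = Real.log x := by rw [hu]; field_simp
      calc _ ≤ (t - 2 + 2 * δ) * Real.log x * x ^ 2 := h1.trans h2
        _ = (t - 2 + 2 * δ) * u * x ^ 2 * Real.log y := by rw [← h6]; ring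
    have h7 : 2 * δ * u ≤ δ := by nlinarith
    have h8 := mul_le_mul_of_nonneg_right h7 (sq_nonneg x)
    linarith
  have hcover : D ⊆ good ∪ bad := by
    intro ab hab
    rw [Finset.mem_union, hgood, hbad, Finset.mem_filter, Finset.mem_filter]
    by_cases h : (Pplus (Φ ab.1 ab.2).natAbs : ℝ) ≤ y
    · have hab' := Finset.mem_product.mp hab
      exact Or.inl ⟨hab, hΦ0 ab.1 hab'.1 ab.2 hab'.2, h⟩
    · exact Or.inr ⟨hab, exists_prime_dvd_of_lt_Pplus hy1 (not_le.mp h)⟩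
  have hcard : (N : ℝ) ^ 2 ≤ good.card + bad.card := by
    have h1 := (Finset.card_le_card hcover).trans (Finset.card_union_le _ _)
    rw [hD, Finset.card_product, Nat.card_Icc, Nat.add_sub_cancel, ← sq] at h1
    exact_mod_cast h1
  have hNsq : x ^ 2 - 2 * x ≤ (N : ℝ) ^ 2 := by nlinarith
  have hxsq : 2 * x ≤ δ * x ^ 2 := by nlinarith
  have hfin : 2 * δ * x ^ 2 ≤ ε * x ^ 2 := mul_le_mul_of_nonneg_right hδε (sq_nonneg x)
  linarith
end

section
/- Let k ≥ 1 be an integer, κ > 0, A ≥ 0, and let γ : ℕ⁺ → [0,∞) be a function satisfying |∑_{p ≤ z, p prime} γ(p)·log p/p − κ·log z| ≤ A for all z ≥ 2. Then there exists a constant D, depending only on k, κ and A, such that for every real y ≥ 2, every real C > 0, every convex set U ⊆ [0,1]^k and every continuously differentiable function f : U → ℂ with sup_{t∈U}|f(t)| + ∑_{j=1}^k sup_{t∈U}|∂f/∂t_j(t)| ≤ C, one has |∑_{p_1,…,p_k primes, (log p_1/log y, …, log p_k/log y) ∈ U} f(log p_1/log y, …, log p_k/log y)·∏_{j=1}^k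 γ(p_j)·log p_j/(p_j·log y) − κ^k·∫_U f(t) dt| ≤ D·C/log y. -/
open MeasureTheory

theorem measurable_indicator_of_monotoneOn {I : Set ℝ} (hI : I.OrdConnected) {φ : ℝ → ℝ}
    (hφ : MonotoneOn φ I) : Measurable (I.indicator φ) := by
  have hmono : Monotone (I.domRestrict φ) := fun a b hab => hφ a.2 b.2 hab
  refine measurable_of_restrict_of_restrict_compl hI.measurableSet ?_ ?_
  · convert hmono.measurable using 1
    ext s
    simp
  · convert measurable_const (a := (0 : ℝ)) using 1
    ext s
    simpa using fun h => absurd h s.2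

/-- Two finite measures that are close on the order-connected subsets of `I` integrate monotone
functions on `I` to nearby values. -/
theorem abs_integral_indicator_sub_le_of_monotoneOn (μ ν : Measure ℝ) [IsFiniteMeasure μ]
    [IsFiniteMeasure ν] {I : Set ℝ} (hI : I.OrdConnected) {E M : ℝ} (hM : 0 ≤ M)
    (hE : ∀ J : Set ℝ, J.OrdConnected → J ⊆ I → |μ.real J - ν.real J| ≤ E)
    {φ : ℝ → ℝ} (hφ : MonotoneOn φ I) (h0 : ∀ s ∈ I, 0 ≤ φ s) (h1 : ∀ s ∈ I, φ s ≤ M) :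
    Integrable (I.indicator φ) μ ∧
      |∫ s, I.indicator φ s ∂μ - ∫ s, I.indicator φ s ∂ν| ≤ M * E := by
  have hmeas := measurable_indicator_of_monotoneOn hI hφ
  have hnn : ∀ s, 0 ≤ I.indicator φ s := fun s => Set.indicator_nonneg h0 s
  have hle : ∀ s, I.indicator φ s ≤ M := fun s => Set.indicator_apply_le' (h1 s) fun _ => hM
  have hint : ∀ (ρ : Measure ℝ) [IsFiniteMeasure ρ], Integrable (I.indicator φ) ρ := by
    intro ρ _
    refine Integrable.of_bound hmeas.aestronglyMeasurable M (Filter.Eventually.of_forall fun s => ?_)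
    rw [Real.norm_of_nonneg (hnn s)]
    exact hle s
  have hlayer : ∀ (ρ : Measure ℝ) [IsFiniteMeasure ρ], IntegrableOn
      (fun t => ρ.real {a | t ≤ I.indicator φ a}) (Set.Ioc 0 M) := by
    intro ρ _
    have : Antitone fun t => ρ.real {a | t ≤ I.indicator φ a} := fun s t hst =>
      measureReal_mono fun a (ha : t ≤ _) => hst.trans ha
    exact ((this.antitoneOn _).integrableOn_isCompact isCompact_Icc).mono_set
      Set.Ioc_subset_Icc_self
  refine ⟨hint μ, ?_⟩
  rw [(hint μ).integral_eq_integral_Ioc_meas_le (.of_forall hnn) (.of_forall hle),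
    (hint ν).integral_eq_integral_Ioc_meas_le (.of_forall hnn) (.of_forall hle),
    ← integral_sub (hlayer μ) (hlayer ν), ← Real.norm_eq_abs]
  refine (norm_setIntegral_le_of_norm_le_const (C := E) (by simp) fun t ht => ?_).trans ?_
  · have hset : {a | t ≤ I.indicator φ a} = {a ∈ I | t ≤ φ a} := by
      ext a
      by_cases ha : a ∈ I
      · simp [ha]
      · simp [ha, ht.1]
    rw [Real.norm_eq_abs, hset]
    refine hE _ ⟨fun a ha b hb c hc => ?_⟩ (Set.sep_subset _ _)
    have hcI := hI.out ha.1 hb.1 hc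
    exact ⟨hcI, ha.2.trans (hφ ha.1 hcI hc.1)⟩
  · simp [hM, mul_comm]

theorem abs_integral_indicator_sub_le_of_lipschitz (μ ν : Measure ℝ) [IsFiniteMeasure μ]
    [IsFiniteMeasure ν] {I : Set ℝ} (hI : I.OrdConnected) (hI01 : I ⊆ Set.Icc 0 1) {E C : ℝ}
    (hC : 0 ≤ C) (hE : ∀ J : Set ℝ, J.OrdConnected → J ⊆ I → |μ.real J - ν.real J| ≤ E)
    {g : ℝ → ℝ} (hg : ∀ s ∈ I, |g s| ≤ C) (hl : ∀ s ∈ I, ∀ t ∈ I, |g s - g t| ≤ C * |s - t|) :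
    |∫ s, I.indicator g s ∂μ - ∫ s, I.indicator g s ∂ν| ≤ 5 * C * E := by
  have hψ : MonotoneOn (fun s => C * s + C) I := fun s _ t _ hst => by
    dsimp only; gcongr
  have hφ : MonotoneOn (fun s => g s + (C * s + C)) I := fun s hs t ht hst => by
    have := hl s hs t ht
    rw [abs_sub_comm s t, abs_of_nonneg (sub_nonneg.2 hst)] at this
    linarith [le_abs_self (g s - g t)]
  have key : ∀ s ∈ I, 0 ≤ C * s ∧ C * s ≤ C := fun s hs =>
    ⟨mul_nonneg hC (hI01 hs).1, mul_le_of_le_one_right hC (hI01 hs).2⟩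
  have bφ : ∀ s ∈ I, 0 ≤ g s + (C * s + C) := fun s hs => by
    linarith [key s hs, abs_le.1 (hg s hs)]
  have bφ' : ∀ s ∈ I, g s + (C * s + C) ≤ 3 * C := fun s hs => by
    linarith [key s hs, abs_le.1 (hg s hs)]
  have bψ : ∀ s ∈ I, 0 ≤ C * s + C := fun s hs => by linarith [key s hs]
  have bψ' : ∀ s ∈ I, C * s + C ≤ 2 * C := fun s hs => by linarith [key s hs]
  have hE' : ∀ J : Set ℝ, J.OrdConnected → J ⊆ I → |ν.real J - μ.real J| ≤ E :=
    fun J h h' => by rw [abs_sub_comm]; exact hE J h h'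
  have eφ := abs_integral_indicator_sub_le_of_monotoneOn μ ν hI (by positivity) hE hφ bφ bφ'
  have eψ := abs_integral_indicator_sub_le_of_monotoneOn μ ν hI (by positivity) hE hψ bψ bψ'
  have eφ' := abs_integral_indicator_sub_le_of_monotoneOn ν μ hI (by positivity) hE' hφ bφ bφ'
  have eψ' := abs_integral_indicator_sub_le_of_monotoneOn ν μ hI (by positivity) hE' hψ bψ bψ'
  have hsplit : I.indicator g = fun s => I.indicator (fun s => g s + (C * s + C)) s -
      I.indicator (fun s => C * s + C) s := by
    ext s
    by_cases hs : s ∈ I <;> simp [hs]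
  rw [hsplit, integral_sub eφ.1 eψ.1, integral_sub eφ'.1 eψ'.1]
  have h1 := abs_le.1 eφ.2
  have h2 := abs_le.1 eψ.2
  rw [abs_le]
  constructor <;> linarith [h1.1, h1.2, h2.1, h2.2]

/-- A bound for the distribution function of a measure on `[0, 1]` controls its values on all
order-connected sets. -/
theorem abs_measureReal_sub_le_of_cdf (μ : Measure ℝ) [IsFiniteMeasure μ] {κ E : ℝ} (hκ : 0 ≤ κ)
    (hE : 0 ≤ E) (h : ∀ t ∈ Set.Icc (0 : ℝ) 1, |μ.real (Set.Iic t) - κ * t| ≤ E)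
    {J : Set ℝ} (hJ : J.OrdConnected) (hJ01 : J ⊆ Set.Icc 0 1) :
    |μ.real J - κ * volume.real J| ≤ 2 * E := by
  rcases J.eq_empty_or_nonempty with rfl | hne
  · simpa using hE
  have hbb : BddBelow J := bddBelow_Icc.mono hJ01
  have hba : BddAbove J := bddAbove_Icc.mono hJ01
  set a := sInf J with ha
  set b := sSup J with hb
  have ha0 : 0 ≤ a := le_csInf hne fun s hs => (hJ01 hs).1
  have hb1 : b ≤ 1 := csSup_le hne fun s hs => (hJ01 hs).2
  have hab : a ≤ b := csInf_le_csSup hne hbb hba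
  have hsub : J ⊆ Set.Icc a b := fun s hs => ⟨csInf_le hbb hs, le_csSup hba hs⟩
  have hsup : Set.Ioo a b ⊆ J := IsConnected.Ioo_csInf_csSup_subset ⟨hne, hJ.isPreconnected⟩ hbb hba
  have hvol : volume.real J = b - a := by
    apply le_antisymm
    · refine (measureReal_mono hsub (by simp)).trans ?_
      simp [hab]
    · refine le_trans ?_ (measureReal_mono hsup ((measure_mono hsub).trans_lt (by simp)).ne)
      simp [hab]
  have lower : ∀ t ≤ 1, κ * t - E ≤ μ.real (Set.Iic t) := fun t ht => by
    rcases le_total 0 t with h0 | h0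
    · linarith [abs_le.1 (h t ⟨h0, ht⟩)]
    · linarith [mul_nonpos_of_nonneg_of_nonpos hκ h0, measureReal_nonneg (μ := μ) (s := Set.Iic t)]
  have hub : ∀ a' < a, μ.real J ≤ κ * (b - a') + 2 * E := fun a' ha' => by
    have h1 : μ.real J + μ.real (Set.Iic a') ≤ μ.real (Set.Iic b) := by
      rw [← measureReal_union _ measurableSet_Iic]
      · refine measureReal_mono (Set.union_subset (fun s hs => (hsub hs).2) ?_)
        exact Set.Iic_subset_Iic.2 (ha'.le.trans hab)
      · rw [Set.disjoint_left]
        intro s hs hs'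
        exact absurd (hsub hs).1 (not_le.2 (lt_of_le_of_lt hs' ha'))
    linarith [lower a' (by linarith), abs_le.1 (h b ⟨ha0.trans hab, hb1⟩)]
  have hlb : ∀ b' < b, κ * (b' - a) - 2 * E ≤ μ.real J := fun b' hb' => by
    have h1 : μ.real (Set.Iic b') ≤ μ.real J + μ.real (Set.Iic a) := by
      refine le_trans (measureReal_mono ?_) (measureReal_union_le _ _)
      intro s hs
      rcases le_or_gt s a with h | h
      · exact Or.inr h
      · exact Or.inl (hsup ⟨h, lt_of_le_of_lt hs hb'⟩)
    linarith [lower b' (by linarith), abs_le.1 (h a ⟨ha0, hab.trans hb1⟩)]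
  have hub' : μ.real J ≤ κ * (b - a) + 2 * E := by
    have hc : Continuous fun a' => κ * (b - a') + 2 * E := by fun_prop
    exact ge_of_tendsto (hc.continuousWithinAt (s := Set.Iio a) (x := a))
      (by filter_upwards [self_mem_nhdsWithin] with a' ha' using hub a' ha')
  have hlb' : κ * (b - a) - 2 * E ≤ μ.real J := by
    have hc : Continuous fun b' => κ * (b' - a) - 2 * E := by fun_prop
    exact le_of_tendsto (hc.continuousWithinAt (s := Set.Iio b) (x := b))
      (by filter_upwards [self_mem_nhdsWithin] with b' hb' using hlb b' hb')
  rw [hvol, abs_le]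
  constructor <;> linarith

theorem Convex.integrableOn_of_continuousOn_of_bounded {k : ℕ} {F : Type*} [NormedAddCommGroup F]
    {U : Set (Fin k → ℝ)} (hU : Convex ℝ U) (hU01 : U ⊆ Set.Icc 0 1) {f : (Fin k → ℝ) → F}
    (hf : ContinuousOn f U) {C : ℝ} (hC : ∀ t ∈ U, ‖f t‖ ≤ C) : IntegrableOn f U := by
  have hae : interior U =ᵐ[volume] U :=
    interior_ae_eq_of_null_frontier (hU.addHaar_frontier volume)
  have hfin : volume (interior U) < ⊤ :=
    (measure_mono (interior_subset.trans hU01)).trans_lt isCompact_Icc.measure_lt_top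
  refine IntegrableOn.congr_set_ae ?_ hae.symm
  refine IntegrableOn.of_bound hfin
    ((hf.mono interior_subset).aestronglyMeasurable isOpen_interior.measurableSet) C ?_
  exact (ae_restrict_iff' isOpen_interior.measurableSet).2
    (.of_forall fun t ht => hC t (interior_subset ht))

/-- The measure placing mass `w i` at the point `x i`. -/
noncomputable def weightedDirac {ι : Type*} [Fintype ι] (x w : ι → ℝ) : Measure ℝ :=
  ∑ i, ENNReal.ofReal (w i) • Measure.dirac (x i)

instance {ι : Type*} [Fintype ι] (x w : ι → ℝ) : IsFiniteMeasure (weightedDirac x w) := by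
  have (i : ι) : IsFiniteMeasure (ENNReal.ofReal (w i) • Measure.dirac (x i)) :=
    Measure.smul_finite _ (by simp)
  exact ⟨by simp [weightedDirac, Measure.finsetSum_apply, ENNReal.sum_lt_top]⟩

theorem integral_weightedDirac {ι : Type*} [Fintype ι] {x w : ι → ℝ} (hw : ∀ i, 0 ≤ w i)
    (g : ℝ → ℝ) : ∫ s, g s ∂(weightedDirac x w) = ∑ i, w i * g (x i) := by
  unfold weightedDirac
  rw [integral_finsetSum_measure]
  · simp [integral_smul_measure, hw]
  · intro i _
    refine Integrable.smul_measure ?_ (by simp)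
    exact integrable_dirac (by simp)

theorem weightedDirac_real_apply {ι : Type*} [Fintype ι] {x w : ι → ℝ} (hw : ∀ i, 0 ≤ w i)
    {J : Set ℝ} (hJ : MeasurableSet J) :
    (weightedDirac x w).real J = ∑ i, w i * J.indicator 1 (x i) := by
  rw [← integral_weightedDirac hw, integral_indicator_one hJ]

theorem abs_sum_indicator_sub_integral_le {ι : Type*} [Fintype ι] {x w : ι → ℝ}
    (hw : ∀ i, 0 ≤ w i) {κ E : ℝ} (hκ : 0 ≤ κ)
    (hD : ∀ J : Set ℝ, J.OrdConnected → J ⊆ Set.Icc 0 1 →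
      |(weightedDirac x w).real J - κ * volume.real J| ≤ E)
    {I : Set ℝ} (hI : I.OrdConnected) (hI01 : I ⊆ Set.Icc 0 1) {C : ℝ} (hC : 0 ≤ C)
    {g : ℝ → ℝ} (hg : ∀ s ∈ I, |g s| ≤ C) (hl : ∀ s ∈ I, ∀ t ∈ I, |g s - g t| ≤ C * |s - t|) :
    |∑ i, w i * I.indicator g (x i) - κ * ∫ s, I.indicator g s| ≤ 5 * C * E := by
  have : IsFiniteMeasure (ENNReal.ofReal κ • (volume.restrict (Set.Icc (0 : ℝ) 1))) :=
    Measure.smul_finite _ (by simp)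
  have := abs_integral_indicator_sub_le_of_lipschitz (weightedDirac x w)
    (ENNReal.ofReal κ • (volume.restrict (Set.Icc (0 : ℝ) 1))) hI hI01 hC (E := E) ?_ hg hl
  · rw [integral_weightedDirac hw, integral_smul_measure, ENNReal.toReal_ofReal hκ,
      setIntegral_eq_integral_of_forall_compl_eq_zero] at this
    · exact this
    · exact fun s hs => Set.indicator_of_notMem (fun h => hs (hI01 h)) _
  · intro J hJ hJI
    have h01 := hJI.trans hI01
    rw [measureReal_ennreal_smul_apply, ENNReal.toReal_ofReal hκ,
      measureReal_restrict_apply hJ.measurableSet, Set.inter_eq_left.2 h01]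
    exact hD J hJ h01

theorem integral_fin_succ {k : ℕ} {F : (Fin (k + 1) → ℝ) → ℝ} (hF : Integrable F) :
    Integrable (fun s : ℝ => ∫ v : Fin k → ℝ, F (Fin.cons s v)) ∧
      ∫ t, F t = ∫ s : ℝ, ∫ v : Fin k → ℝ, F (Fin.cons s v) := by
  have hsymm : ∀ q : ℝ × (Fin k → ℝ),
      (MeasurableEquiv.piFinSuccAbove (fun _ : Fin (k + 1) => ℝ) 0).symm q =
        Fin.cons q.1 q.2 := fun q => by
    ext j
    simp [MeasurableEquiv.piFinSuccAbove]
  have mp := (volume_preserving_piFinSuccAbove (fun _ : Fin (k + 1) => ℝ) 0).symm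
  have hF' : Integrable (fun q : ℝ × (Fin k → ℝ) => F (Fin.cons q.1 q.2)) := by
    have := (mp.integrable_comp_emb (MeasurableEquiv.measurableEmbedding _)).2 hF
    simp only [Function.comp_def, hsymm] at this
    exact this
  refine ⟨hF'.integral_prod_left, ?_⟩
  rw [← integral_prod _ hF']
  have := mp.integral_comp (MeasurableEquiv.measurableEmbedding _) F
  simp only [hsymm] at this
  exact this.symm

/-- The error constant accumulated when `k` coordinates are smoothed one after the other. -/
def errorConst (κ W : ℝ) : ℕ → ℝ
  | 0 => 0
  | k + 1 => W ^ k + κ * errorConst κ W k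

theorem abs_sum_pi_indicator_sub_integral_le {ι : Type*} [Fintype ι] {x w : ι → ℝ}
    (hw : ∀ i, 0 ≤ w i) {κ E W : ℝ} (hκ : 0 ≤ κ) (hE : 0 ≤ E) (hW : ∑ i, w i ≤ W)
    (hD : ∀ J : Set ℝ, J.OrdConnected → J ⊆ Set.Icc 0 1 →
      |(weightedDirac x w).real J - κ * volume.real J| ≤ E) {C : ℝ} (hC : 0 ≤ C) (k : ℕ)
    {U : Set (Fin k → ℝ)} (hU : Convex ℝ U) (hU01 : U ⊆ Set.Icc 0 1) {f : (Fin k → ℝ) → ℝ}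
    (hf : ∀ t ∈ U, |f t| ≤ C) (hl : ∀ s ∈ U, ∀ t ∈ U, |f s - f t| ≤ C * ‖s - t‖) :
    |∑ q : Fin k → ι, (∏ j, w (q j)) * U.indicator f (fun j => x (q j)) -
      κ ^ k * ∫ t, U.indicator f t| ≤ 5 * C * E * errorConst κ W k := by
  induction k with
  | zero =>
    have h : ∀ t : Fin 0 → ℝ, t = 0 := fun t => Subsingleton.elim _ _
    have hU : ∀ t : Fin 0 → ℝ, U.indicator f t = U.indicator f 0 := fun t => by rw [h t]
    simp [errorConst, hU, Measure.real, volume_pi]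
  | succ k ih =>
    have hcont : ContinuousOn f U := by
      have : LipschitzOnWith (Real.toNNReal C) f U :=
        LipschitzOnWith.of_dist_le_mul fun s hs t ht => by
          rw [Real.coe_toNNReal _ hC, Real.dist_eq, dist_eq_norm]
          exact hl s hs t ht
      exact this.continuousOn
    have hint : Integrable (U.indicator f) :=
      (hU.integrableOn_of_continuousOn_of_bounded hU01 hcont hf).integrable_indicator₀
        (hU.nullMeasurableSet volume)
    have hFub := integral_fin_succ hint
    have hslice : ∀ v : Fin k → ℝ, Convex ℝ {s : ℝ | (Fin.cons s v : Fin (k + 1) → ℝ) ∈ U} := by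
      intro v s hs t ht a b ha hb hab
      have := hU hs ht ha hb hab
      rw [Set.mem_ofPred_eq]
      convert this
      ext j
      refine Fin.cases ?_ (fun j => ?_) j
      · simp
      · simp [← add_mul, hab]
    have hslice' : ∀ s : ℝ, Convex ℝ {v : Fin k → ℝ | (Fin.cons s v : Fin (k + 1) → ℝ) ∈ U} := by
      intro s v hv u hu a b ha hb hab
      have := hU hv hu ha hb hab
      rw [Set.mem_ofPred_eq]
      convert this
      ext j
      refine Fin.cases ?_ (fun j => ?_) j
      · simp [← add_mul, hab]
      · simp
    have hslice01 : ∀ v : Fin k → ℝ, {s : ℝ | (Fin.cons s v : Fin (k + 1) → ℝ) ∈ U} ⊆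
        Set.Icc 0 1 := fun v s hs => by
      have := hU01 hs
      exact ⟨by simpa using this.1 0, by simpa using this.2 0⟩
    have hslice01' : ∀ s : ℝ, {v : Fin k → ℝ | (Fin.cons s v : Fin (k + 1) → ℝ) ∈ U} ⊆
        Set.Icc 0 1 := fun s v hv => by
      have := hU01 hv
      exact ⟨fun j => by simpa using this.1 j.succ, fun j => by simpa using this.2 j.succ⟩
    have hind : ∀ (s : ℝ) (v : Fin k → ℝ), U.indicator f (Fin.cons s v) =
        {s : ℝ | (Fin.cons s v : Fin (k + 1) → ℝ) ∈ U}.indicator (fun s => f (Fin.cons s v)) s :=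
      fun s v => rfl
    have hind' : ∀ (s : ℝ) (v : Fin k → ℝ), U.indicator f (Fin.cons s v) =
        {v : Fin k → ℝ | (Fin.cons s v : Fin (k + 1) → ℝ) ∈ U}.indicator
          (fun v => f (Fin.cons s v)) v :=
      fun s v => rfl
    have step1 : ∀ v : Fin k → ℝ, |∑ i, w i * U.indicator f (Fin.cons (x i) v) -
        κ * ∫ s, U.indicator f (Fin.cons s v)| ≤ 5 * C * E := by
      intro v
      simp only [hind]
      refine abs_sum_indicator_sub_integral_le hw hκ hD (hslice v).ordConnected (hslice01 v) hC
        (fun s hs => hf _ hs) (fun s hs t ht => (hl _ hs _ ht).trans ?_)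
      gcongr
      rw [pi_norm_le_iff_of_nonneg (abs_nonneg _)]
      refine Fin.cases ?_ (fun j => ?_)
      · simp
      · simp
    have step2 : ∀ s : ℝ, |∑ q : Fin k → ι, (∏ j, w (q j)) *
        U.indicator f (Fin.cons s fun j => x (q j)) -
        κ ^ k * ∫ v : Fin k → ℝ, U.indicator f (Fin.cons s v)| ≤ 5 * C * E * errorConst κ W k := by
      intro s
      simp only [hind']
      refine ih (hslice' s) (hslice01' s)
        (fun v hv => hf _ hv) (fun v hv u hu => (hl _ hv _ hu).trans ?_)
      gcongr
      rw [pi_norm_le_iff_of_nonneg (norm_nonneg _)]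
      refine Fin.cases ?_ (fun j => ?_)
      · simp
      · simpa using norm_le_pi_norm (v - u) j
    have hint1 : ∀ v : Fin k → ℝ, Integrable fun s : ℝ => U.indicator f (Fin.cons s v) := by
      intro v
      have hc : Continuous fun s : ℝ => (Fin.cons s v : Fin (k + 1) → ℝ) := by
        refine continuous_pi (Fin.cases ?_ fun j => ?_)
        · simpa using continuous_id'
        · simpa using continuous_const
      have hm := (hslice v).ordConnected.measurableSet
      simp only [hind]
      refine (integrable_indicator_iff hm).2 (IntegrableOn.of_bound ?_ ?_ C ?_)
      · exact (measure_mono (hslice01 v)).trans_lt (by simp)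
      · exact (ContinuousOn.comp (t := U) hcont hc.continuousOn fun s hs => hs).aestronglyMeasurable
          hm
      · exact (ae_restrict_iff' hm).2 (.of_forall fun s hs => hf _ hs)
    have hsum : ∑ q : Fin (k + 1) → ι, (∏ j, w (q j)) * U.indicator f (fun j => x (q j)) =
        ∑ q : Fin k → ι, (∏ j, w (q j)) *
          ∑ i, w i * U.indicator f (Fin.cons (x i) fun j => x (q j)) := by
      rw [← (Fin.consEquiv fun _ => ι).sum_comp, Fintype.sum_prod_type_right]
      refine Finset.sum_congr rfl fun q _ => ?_
      rw [Finset.mul_sum]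
      refine Finset.sum_congr rfl fun i _ => ?_
      have : (fun j => x ((Fin.cons i q : Fin (k + 1) → ι) j)) =
          (Fin.cons (x i) fun j => x (q j) : Fin (k + 1) → ℝ) := by
        ext j
        refine Fin.cases ?_ (fun j => ?_) j <;> simp
      simp only [Fin.consEquiv, Equiv.coe_fn_mk, Fin.prod_univ_succ, Fin.cons_zero, Fin.cons_succ,
        this]
      ring
    set G : ℝ → ℝ := fun s => ∑ q : Fin k → ι, (∏ j, w (q j)) *
        U.indicator f (Fin.cons s fun j => x (q j)) with hG
    set H : ℝ → ℝ := fun s => ∫ v : Fin k → ℝ, U.indicator f (Fin.cons s v) with hH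
    have hGint : Integrable G := integrable_finsetSum _ fun q _ => (hint1 _).const_mul _
    have hGeq : ∫ s, G s = ∑ q : Fin k → ι, (∏ j, w (q j)) *
        ∫ s, U.indicator f (Fin.cons s fun j => x (q j)) := by
      rw [hG, integral_finsetSum _ fun q _ => (hint1 _).const_mul _]
      simp only [integral_const_mul]
    have hfirst : |∑ q : Fin (k + 1) → ι, (∏ j, w (q j)) * U.indicator f (fun j => x (q j)) -
        κ * ∫ s, G s| ≤ 5 * C * E * W ^ k := by
      rw [hsum, hGeq, Finset.mul_sum, ← Finset.sum_sub_distrib]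
      refine (Finset.abs_sum_le_sum_abs _ _).trans ?_
      calc _ ≤ ∑ q : Fin k → ι, (∏ j, w (q j)) * (5 * C * E) := by
            refine Finset.sum_le_sum fun q _ => ?_
            have h0 : 0 ≤ ∏ j, w (q j) := Finset.prod_nonneg fun j _ => hw _
            rw [mul_left_comm κ, ← mul_sub, abs_mul, abs_of_nonneg h0]
            exact mul_le_mul_of_nonneg_left (step1 _) h0
        _ = 5 * C * E * (∑ i, w i) ^ k := by
            rw [← Finset.sum_mul, Fintype.sum_pow, mul_comm]
        _ ≤ _ := by
            have := Finset.sum_nonneg fun i (_ : i ∈ Finset.univ) => hw i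
            gcongr
    have hzero : ∀ s ∉ Set.Icc (0 : ℝ) 1, G s - κ ^ k * H s = 0 := by
      intro s hs
      have : ∀ v : Fin k → ℝ, U.indicator f (Fin.cons s v) = 0 := fun v =>
        Set.indicator_of_notMem (fun h : _ ∈ U => hs (hslice01 v h)) _
      simp [hG, hH, this]
    have hsecond : |(∫ s, G s) - κ ^ k * ∫ t, U.indicator f t| ≤ 5 * C * E * errorConst κ W k := by
      rw [hFub.2, ← integral_const_mul _ H, ← integral_sub hGint (hFub.1.const_mul _),
        ← setIntegral_eq_integral_of_forall_compl_eq_zero hzero, ← Real.norm_eq_abs]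
      refine (norm_setIntegral_le_of_norm_le_const (by simp) fun s _ => step2 s).trans ?_
      simp
    calc _ = |(∑ q : Fin (k + 1) → ι, (∏ j, w (q j)) * U.indicator f (fun j => x (q j)) -
          κ * ∫ s, G s) + κ * ((∫ s, G s) - κ ^ k * ∫ t, U.indicator f t)| := by
          congr 1
          ring
      _ ≤ 5 * C * E * W ^ k + κ * (5 * C * E * errorConst κ W k) := by
          refine (abs_add_le _ _).trans (add_le_add hfirst ?_)
          rw [abs_mul, abs_of_nonneg hκ]
          exact mul_le_mul_of_nonneg_left hsecond hκ
      _ = _ := by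
          rw [errorConst]
          ring

theorem norm_sum_pi_indicator_sub_integral_le {ι : Type*} [Fintype ι] {x w : ι → ℝ}
    (hw : ∀ i, 0 ≤ w i) {κ E W : ℝ} (hκ : 0 ≤ κ) (hE : 0 ≤ E) (hW : ∑ i, w i ≤ W)
    (hD : ∀ J : Set ℝ, J.OrdConnected → J ⊆ Set.Icc 0 1 →
      |(weightedDirac x w).real J - κ * volume.real J| ≤ E) {C : ℝ} (hC : 0 ≤ C) {k : ℕ}
    {U : Set (Fin k → ℝ)} (hU : Convex ℝ U) (hU01 : U ⊆ Set.Icc 0 1) {f : (Fin k → ℝ) → ℂ}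
    (hf : ∀ t ∈ U, ‖f t‖ ≤ C) (hl : ∀ s ∈ U, ∀ t ∈ U, ‖f s - f t‖ ≤ C * ‖s - t‖) :
    ‖∑ q : Fin k → ι, U.indicator f (fun j => x (q j)) * ((∏ j, w (q j) : ℝ) : ℂ) -
      (κ : ℂ) ^ k * ∫ t in U, f t‖ ≤ 10 * C * E * errorConst κ W k := by
  have hcont : ContinuousOn f U := by
    have : LipschitzOnWith (Real.toNNReal C) f U :=
      LipschitzOnWith.of_dist_le_mul fun s hs t ht => by
        rw [Real.coe_toNNReal _ hC, dist_eq_norm, dist_eq_norm]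
        exact hl s hs t ht
    exact this.continuousOn
  have hint := hU.integrableOn_of_continuousOn_of_bounded hU01 hcont hf
  have hre := abs_sum_pi_indicator_sub_integral_le hw hκ hE hW hD hC k hU hU01
    (f := fun t => (f t).re) (fun t ht => (Complex.abs_re_le_norm _).trans (hf t ht))
    (fun s hs t ht => by
      rw [← Complex.sub_re]
      exact (Complex.abs_re_le_norm _).trans (hl s hs t ht))
  have him := abs_sum_pi_indicator_sub_integral_le hw hκ hE hW hD hC k hU hU01
    (f := fun t => (f t).im) (fun t ht => (Complex.abs_im_le_norm _).trans (hf t ht))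
    (fun s hs t ht => by
      rw [← Complex.sub_im]
      exact (Complex.abs_im_le_norm _).trans (hl s hs t ht))
  rw [integral_indicator₀ (hU.nullMeasurableSet volume)] at hre him
  have eRe : ∫ t in U, (f t).re = (∫ t in U, f t).re := Complex.reCLM.integral_comp_comm hint
  have eIm : ∫ t in U, (f t).im = (∫ t in U, f t).im := Complex.imCLM.integral_comp_comm hint
  have iRe : ∀ t, U.indicator (fun t => (f t).re) t = (U.indicator f t).re := fun t => by
    by_cases ht : t ∈ U <;> simp [ht]
  have iIm : ∀ t, U.indicator (fun t => (f t).im) t = (U.indicator f t).im := fun t => by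
    by_cases ht : t ∈ U <;> simp [ht]
  simp only [eRe, eIm, iRe, iIm] at hre him
  refine (Complex.norm_le_abs_re_add_abs_im _).trans ?_
  rw [Complex.sub_re, Complex.sub_im, Complex.re_sum, Complex.im_sum, ← Complex.ofReal_pow,
    Complex.re_ofReal_mul, Complex.im_ofReal_mul]
  simp only [Complex.re_mul_ofReal, Complex.im_mul_ofReal]
  simp only [mul_comm (∏ _, _)] at hre him
  linarith

theorem norm_sub_le_of_fderivWithin_single {k : ℕ} {U : Set (Fin k → ℝ)} (hU : Convex ℝ U)
    {f : (Fin k → ℝ) → ℂ} (hf : DifferentiableOn ℝ f U) {C : ℝ} (hC : 0 ≤ C)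
    (h : ∀ t ∈ U, ∑ j : Fin k, ‖fderivWithin ℝ f U t (Pi.single j 1)‖ ≤ C) :
    ∀ s ∈ U, ∀ t ∈ U, ‖f s - f t‖ ≤ C * ‖s - t‖ := by
  intro s hs t ht
  refine hU.norm_image_sub_le_of_norm_fderivWithin_le hf (fun u hu => ?_) ht hs
  refine ContinuousLinearMap.opNorm_le_bound _ hC fun v => ?_
  have hv : v = ∑ j, v j • (Pi.single j (1 : ℝ) : Fin k → ℝ) := by
    ext i
    simp [Finset.sum_apply, Pi.single_apply]
  calc ‖fderivWithin ℝ f U u v‖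
      = ‖∑ j, v j • fderivWithin ℝ f U u (Pi.single j 1)‖ := by
        conv_lhs => rw [hv]
        simp only [map_sum, map_smul]
    _ ≤ ∑ j, ‖v‖ * ‖fderivWithin ℝ f U u (Pi.single j 1)‖ := by
        refine (norm_sum_le _ _).trans (Finset.sum_le_sum fun j _ => ?_)
        rw [norm_smul]
        gcongr
        exact norm_le_pi_norm v j
    _ ≤ C * ‖v‖ := by
        rw [← Finset.mul_sum, mul_comm]
        gcongr
        exact h u hu

/-- The primes up to `y`. -/
noncomputable def primesUpTo (y : ℝ) : Finset ℕ := (Finset.range (⌊y⌋₊ + 1)).filter Nat.Prime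

theorem mem_primesUpTo {y : ℝ} (hy : 0 ≤ y) {p : ℕ} :
    p ∈ primesUpTo y ↔ p.Prime ∧ (p : ℝ) ≤ y := by
  simp [primesUpTo, Nat.le_floor_iff hy, and_comm]

theorem abs_sum_primesUpTo_sub_le {γ : ℕ → ℝ} {κ A : ℝ} (hκ : 0 ≤ κ) (hA : 0 ≤ A)
    (h : ∀ z : ℝ, 2 ≤ z → |(∑ p ∈ primesUpTo z, γ p * Real.log p / p) - κ * Real.log z| ≤ A)
    {z : ℝ} (hz : 1 ≤ z) :
    |(∑ p ∈ primesUpTo z, γ p * Real.log p / p) - κ * Real.log z| ≤ A + κ * Real.log 2 := by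
  rcases le_or_gt 2 z with h2 | h2
  · exact (h z h2).trans (le_add_of_nonneg_right (mul_nonneg hκ (Real.log_nonneg one_le_two)))
  · have hempty : primesUpTo z = ∅ := by
      refine Finset.eq_empty_of_forall_notMem fun p hp => ?_
      obtain ⟨hp, hpz⟩ := (mem_primesUpTo (by linarith)).1 hp
      have : (2 : ℝ) ≤ p := by exact_mod_cast hp.two_le
      linarith
    rw [hempty, Finset.sum_empty, zero_sub, abs_neg,
      abs_of_nonneg (mul_nonneg hκ (Real.log_nonneg hz))]
    have : κ * Real.log z ≤ κ * Real.log 2 := by gcongr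
    linarith

theorem abs_weightedDirac_primes_Iic_sub_le {γ : ℕ → ℝ} (hγ : ∀ n : ℕ, 0 < n → 0 ≤ γ n) {κ A : ℝ}
    (hκ : 0 ≤ κ) (hA : 0 ≤ A)
    (h : ∀ z : ℝ, 2 ≤ z → |(∑ p ∈ primesUpTo z, γ p * Real.log p / p) - κ * Real.log z| ≤ A)
    {y : ℝ} (hy : 2 ≤ y) {t : ℝ} (ht : t ∈ Set.Icc (0 : ℝ) 1) :
    |(weightedDirac (fun p : primesUpTo y => Real.log (p : ℕ) / Real.log y)
      (fun p => γ p * Real.log (p : ℕ) / ((p : ℕ) * Real.log y))).real (Set.Iic t) - κ * t| ≤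
      (A + κ * Real.log 2) / Real.log y := by
  have hy0 : 0 < y := by linarith
  have hL : 0 < Real.log y := Real.log_pos (by linarith)
  have hw : ∀ p : primesUpTo y, 0 ≤ γ p * Real.log (p : ℕ) / ((p : ℕ) * Real.log y) := fun p => by
    have := hγ p ((mem_primesUpTo hy0.le).1 p.2).1.pos
    have := Real.log_natCast_nonneg p
    positivity
  have hz : 1 ≤ y ^ t := Real.one_le_rpow (by linarith) ht.1
  have key := abs_sum_primesUpTo_sub_le hκ hA h hz
  have hsub : (primesUpTo y).filter (fun p : ℕ => Real.log p / Real.log y ≤ t) =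
      primesUpTo (y ^ t) := by
    ext p
    rw [Finset.mem_filter, mem_primesUpTo hy0.le, mem_primesUpTo (by linarith), and_assoc]
    refine and_congr_right fun hp => ?_
    have hp0 : (0 : ℝ) < p := by exact_mod_cast hp.pos
    rw [div_le_iff₀ hL, ← Real.le_rpow_iff_log_le hp0 hy0, and_iff_right_iff_imp]
    exact fun h => h.trans (Real.rpow_le_self_of_one_le (by linarith) ht.2)
  have hsum : (weightedDirac (fun p : primesUpTo y => Real.log (p : ℕ) / Real.log y)
      (fun p => γ p * Real.log (p : ℕ) / ((p : ℕ) * Real.log y))).real (Set.Iic t) =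
      (∑ p ∈ primesUpTo (y ^ t), γ p * Real.log p / p) / Real.log y := by
    rw [weightedDirac_real_apply hw measurableSet_Iic, Finset.sum_coe_sort (primesUpTo y)
      (fun p : ℕ => γ p * Real.log p / (p * Real.log y) *
        (Set.Iic t).indicator 1 (Real.log p / Real.log y)), ← hsub, Finset.sum_filter,
      Finset.sum_div]
    refine Finset.sum_congr rfl fun p _ => ?_
    simp only [Set.indicator_apply, Set.mem_Iic, Pi.one_apply]
    split_ifs
    · rw [mul_one, div_div]
    · simp
  rw [Real.log_rpow hy0] at key
  rw [hsum, show κ * t = κ * (t * Real.log y) / Real.log y by field_simp, ← sub_div, abs_div,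
    abs_of_pos hL]
  gcongr

/-- Multidimensional Mertens-type estimate (Lemme 3.9). The constant `D` depends
only on `k`, `κ` and `A`. -/
theorem mertens_multidimensional (k : ℕ) (hk : 1 ≤ k) (κ A : ℝ) (hκ : 0 < κ) (hA : 0 ≤ A) :
    ∃ D : ℝ,
      ∀ γ : ℕ → ℝ, (∀ n : ℕ, 0 < n → 0 ≤ γ n) →
      (∀ z : ℝ, 2 ≤ z →
        |(∑ p ∈ (Finset.range (⌊z⌋₊ + 1)).filter Nat.Prime, γ p * Real.log p / p)
          - κ * Real.log z| ≤ A) →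
      ∀ y : ℝ, 2 ≤ y → ∀ C : ℝ, 0 < C →
      ∀ U : Set (Fin k → ℝ), Convex ℝ U → U ⊆ Set.Icc 0 1 →
      ∀ f : (Fin k → ℝ) → ℂ, ContDiffOn ℝ 1 f U →
        (∀ t ∈ U, ‖f t‖ + ∑ j : Fin k, ‖fderivWithin ℝ f U t (Pi.single j 1)‖ ≤ C) →
        ‖(∑' p : Fin k → ℕ,
            Set.indicator
              {q : Fin k → ℕ | (∀ i, (q i).Prime) ∧
                (fun i => Real.log (q i) / Real.log y) ∈ U}
              (fun q => f (fun i => Real.log (q i) / Real.log y) *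
                ((∏ j, γ (q j) * Real.log (q j) / ((q j : ℝ) * Real.log y) : ℝ) : ℂ)) p)
          - (κ : ℂ) ^ k * ∫ t in U, f t‖ ≤ D * C / Real.log y := by
  set B := A + κ * Real.log 2
  have hB0 : 0 ≤ B := add_nonneg hA (mul_nonneg hκ.le (Real.log_nonneg one_le_two))
  set W := κ + 2 * (B / Real.log 2) with hWdef
  refine ⟨20 * B * errorConst κ W k, ?_⟩
  intro γ hγ hsum y hy C hC U hU hU01 f hf hfC
  have hy0 : 0 < y := by linarith
  have hL : 0 < Real.log y := Real.log_pos (by linarith)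
  set x : primesUpTo y → ℝ := fun p => Real.log (p : ℕ) / Real.log y
  set w : primesUpTo y → ℝ := fun p => γ p * Real.log (p : ℕ) / ((p : ℕ) * Real.log y)
  have hw : ∀ p, 0 ≤ w p := fun p => by
    have := hγ p ((mem_primesUpTo hy0.le).1 p.2).1.pos
    have := Real.log_natCast_nonneg p
    positivity
  have hE0 : 0 ≤ B / Real.log y := div_nonneg hB0 hL.le
  have hD : ∀ J : Set ℝ, J.OrdConnected → J ⊆ Set.Icc 0 1 →
      |(weightedDirac x w).real J - κ * volume.real J| ≤ 2 * (B / Real.log y) :=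
    fun J hJ hJ01 => abs_measureReal_sub_le_of_cdf _ hκ.le hE0
      (fun t ht => abs_weightedDirac_primes_Iic_sub_le hγ hκ.le hA hsum hy ht) hJ hJ01
  have hWle : ∑ p, w p ≤ W := by
    have h1 := (abs_le.1 (hD _ Set.ordConnected_Icc subset_rfl)).2
    have h2 : (weightedDirac x w).real (Set.Icc 0 1) = ∑ p, w p := by
      rw [weightedDirac_real_apply hw measurableSet_Icc]
      refine Finset.sum_congr rfl fun p _ => ?_
      obtain ⟨hp, hpy⟩ := (mem_primesUpTo hy0.le).1 p.2
      have hmem : x p ∈ Set.Icc (0 : ℝ) 1 := by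
        refine ⟨div_nonneg (Real.log_natCast_nonneg _) hL.le, (div_le_one hL).2 ?_⟩
        exact Real.log_le_log (by exact_mod_cast hp.pos) hpy
      rw [Set.indicator_of_mem hmem, Pi.one_apply, mul_one]
    have h3 : B / Real.log y ≤ B / Real.log 2 := by gcongr
    rw [h2, Real.volume_real_Icc] at h1
    rw [sub_zero, max_eq_left zero_le_one, mul_one] at h1
    linarith
  have hlip := norm_sub_le_of_fderivWithin_single hU (hf.differentiableOn (by simp)) hC.le
    fun t ht => (le_add_of_nonneg_left (norm_nonneg _)).trans (hfC t ht)
  have hbd : ∀ t ∈ U, ‖f t‖ ≤ C := fun t ht =>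
    (le_add_of_nonneg_right (Finset.sum_nonneg fun j _ => norm_nonneg _)).trans (hfC t ht)
  have main := norm_sum_pi_indicator_sub_integral_le hw hκ.le (by positivity) hWle hD hC.le hU
    hU01 hbd hlip
  have hinj : Function.Injective
      fun (q : Fin k → primesUpTo y) (j : Fin k) => ((q j : ℕ)) := fun q r hqr => by
    ext j
    exact congrFun hqr j
  rw [← hinj.tsum_eq, tsum_fintype]
  · refine (le_of_eq ?_).trans (main.trans (le_of_eq ?_))
    · congr 2
      refine Finset.sum_congr rfl fun q _ => ?_
      have hq : ∀ i, (q i : ℕ).Prime := fun i => ((mem_primesUpTo hy0.le).1 (q i).2).1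
      by_cases hU' : (fun j => x (q j)) ∈ U
      · rw [Set.indicator_of_mem (Set.mem_ofPred_eq ▸ ⟨hq, hU'⟩), Set.indicator_of_mem hU']
      · rw [Set.indicator_of_notMem fun h => hU' h.2, Set.indicator_of_notMem hU', zero_mul]
    · ring
  · intro p hp
    obtain ⟨hprime, hpU⟩ := Set.mem_of_indicator_ne_zero hp
    refine ⟨fun j => ⟨p j, (mem_primesUpTo hy0.le).2 ⟨hprime j, ?_⟩⟩, rfl⟩
    have h1 : Real.log (p j) / Real.log y ≤ 1 := (hU01 hpU).2 j
    rw [div_le_one hL] at h1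
    exact (Real.log_le_log_iff (by exact_mod_cast (hprime j).pos) hy0).1 h1
end
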